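/- arXiv:2301.09086 — 6 statements merged into one kernel-verified Lean document; each statement's English description precedes it below -/
import Mathlib

section
/- Let u be a classical solution of the wave equation u_tt = u_xx on 0 < x < ℓ(t) with u(0,t) = 0 and the undamped moving-boundary condition u_x(ℓ(t),t) + ℓ′(t) u_t(ℓ(t),t) = 0 for all t > 0 (the case η = 0). Then the energy satisfies E′(t) = −(ℓ′(t)/2)(1 − |ℓ′(t)|²) u_t(ℓ(t),t)² for all t > 0. -/
open Set Filter Topology MeasureTheory

/-- The partial derivative in the first variable of a function differentiable at `(x, t)`. -/
lemma DifferentiableAt.hasDerivAt_slice_fst {f : ℝ × ℝ → ℝ} {x t : ℝ}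
    (hf : DifferentiableAt ℝ f (x, t)) :
    HasDerivAt (fun y => f (y, t)) (fderiv ℝ f (x, t) (1, 0)) x :=
  hf.hasFDerivAt.comp_hasDerivAt x ((hasDerivAt_id x).prodMk (hasDerivAt_const x t))

/-- The partial derivative in the second variable of a function differentiable at `(x, t)`. -/
lemma DifferentiableAt.hasDerivAt_slice_snd {f : ℝ × ℝ → ℝ} {x t : ℝ}
    (hf : DifferentiableAt ℝ f (x, t)) :
    HasDerivAt (fun s => f (x, s)) (fderiv ℝ f (x, t) (0, 1)) t :=
  hf.hasFDerivAt.comp_hasDerivAt t ((hasDerivAt_const t x).prodMk (hasDerivAt_id t))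

/-- Differentiation under the integral sign over a fixed interval, for a function that is `C¹`
near the interval. -/
lemma hasDerivAt_intervalIntegral_of_contDiffOn {F : ℝ × ℝ → ℝ} {U : Set (ℝ × ℝ)}
    (hU : IsOpen U) (hF : ContDiffOn ℝ 1 F U) {a b t₀ : ℝ}
    (hab : ∀ x ∈ uIcc a b, (x, t₀) ∈ U) :
    HasDerivAt (fun t => ∫ x in a..b, F (x, t))
      (∫ x in a..b, fderiv ℝ F (x, t₀) (0, 1)) t₀ := by
  obtain ⟨A, B, -, hB, hA', hB', hAB⟩ := generalized_tube_lemma (isCompact_uIcc (a := a) (b := b))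
    (isCompact_singleton (x := t₀)) hU (by rintro ⟨x, t⟩ ⟨hx, rfl⟩; exact hab x hx)
  obtain ⟨δ, hδ, hδB⟩ := Metric.nhds_basis_closedBall.mem_iff.1 (hB.mem_nhds (hB' rfl))
  have hsub : uIcc a b ×ˢ Metric.closedBall t₀ δ ⊆ U := (prod_mono hA' hδB).trans hAB
  have hcont : ContinuousOn (fun p => fderiv ℝ F p (0, 1)) U :=
    (hF.continuousOn_fderiv_of_isOpen hU le_rfl).clm_apply continuousOn_const
  obtain ⟨C, hC⟩ := (isCompact_uIcc.prod (isCompact_closedBall t₀ δ)).exists_bound_of_continuousOn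
    (hcont.mono hsub)
  have hslice : ∀ t ∈ Metric.closedBall t₀ δ, ∀ G : ℝ × ℝ → ℝ, ContinuousOn G U →
      IntervalIntegrable (fun x => G (x, t)) volume a b := fun t ht G hG =>
    (hG.comp (by fun_prop) fun x hx => hsub ⟨hx, ht⟩).intervalIntegrable
  have hδ' := Metric.closedBall_mem_nhds t₀ hδ
  refine (intervalIntegral.hasDerivAt_integral_of_dominated_loc_of_deriv_le
    (F := fun t x => F (x, t)) (F' := fun t x => fderiv ℝ F (x, t) (0, 1)) (bound := fun _ => C)
    hδ' ?_ (hslice _ (mem_of_mem_nhds hδ') _ hF.continuousOn)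
    (hslice _ (mem_of_mem_nhds hδ') _ hcont).aestronglyMeasurable_restrict_uIoc
    (.of_forall fun x hx t ht => hC (x, t) ⟨uIoc_subset_uIcc hx, ht⟩)
    intervalIntegrable_const (.of_forall fun x hx t ht => ?_)).2
  · filter_upwards [hδ'] with t ht
    exact (hslice t ht _ hF.continuousOn).aestronglyMeasurable_restrict_uIoc
  · have hxt : U ∈ 𝓝 (x, t) := hU.mem_nhds (hsub ⟨uIoc_subset_uIcc hx, ht⟩)
    exact ((hF.contDiffAt hxt).differentiableAt one_ne_zero).hasDerivAt_slice_snd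

/-- The derivative of an integral over a degenerating interval. -/
lemma hasDerivAt_intervalIntegral_moving_endpoint {F : ℝ × ℝ → ℝ} {g : ℝ → ℝ} {g' t₀ : ℝ}
    (hg : HasDerivAt g g' t₀) (hF : ∀ᶠ p in 𝓝 (g t₀, t₀), ContinuousAt F p) :
    HasDerivAt (fun t => ∫ x in (g t₀)..(g t), F (x, t)) (g' * F (g t₀, t₀)) t₀ := by
  have hlin : HasDerivAt (fun t => (g t - g t₀) * F (g t₀, t₀)) (g' * F (g t₀, t₀)) t₀ :=
    (hg.sub_const _).mul_const _
  have hrest : HasDerivAt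
      (fun t => (∫ x in (g t₀)..(g t), F (x, t)) - (g t - g t₀) * F (g t₀, t₀)) 0 t₀ := by
    rw [hasDerivAt_iff_isLittleO]
    simp only [intervalIntegral.integral_same, sub_self, zero_mul, smul_zero, sub_zero]
    refine Asymptotics.IsLittleO.trans_isBigO (Asymptotics.isLittleO_iff.2 fun ε hε => ?_)
      hg.isBigO_sub
    have hnear : ∀ᶠ p in 𝓝 (g t₀, t₀), ‖F p - F (g t₀, t₀)‖ ≤ ε ∧ ContinuousAt F p := by
      refine Filter.Eventually.and ?_ hF
      filter_upwards [hF.self_of_nhds.eventually (Metric.closedBall_mem_nhds _ hε)] with p hp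
      simpa [dist_eq_norm] using hp
    obtain ⟨δ, hδ, hball⟩ := Metric.eventually_nhds_iff_ball.1 hnear
    filter_upwards [hg.continuousAt.eventually (Metric.ball_mem_nhds _ hδ),
      Metric.ball_mem_nhds t₀ hδ] with t hgt ht
    have hmem : ∀ x ∈ uIcc (g t₀) (g t), (x, t) ∈ Metric.ball (g t₀, t₀) δ := fun x hx => by
      rw [← ball_prod_same]
      exact ⟨(convex_ball (g t₀) δ).ordConnected.uIcc_subset (Metric.mem_ball_self hδ) hgt hx, ht⟩
    have hintegrable : IntervalIntegrable (fun x => F (x, t)) volume (g t₀) (g t) :=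
      ContinuousOn.intervalIntegrable fun x hx =>
        ((hball _ (hmem x hx)).2.comp (f := fun y : ℝ => (y, t)) (by fun_prop)).continuousWithinAt
    have heq : (∫ x in (g t₀)..(g t), F (x, t)) - (g t - g t₀) * F (g t₀, t₀)
        = ∫ x in (g t₀)..(g t), (F (x, t) - F (g t₀, t₀)) := by
      rw [intervalIntegral.integral_sub hintegrable intervalIntegrable_const,
        intervalIntegral.integral_const, smul_eq_mul]
    rw [heq, Real.norm_eq_abs (g t - g t₀)]
    exact intervalIntegral.norm_integral_le_of_norm_le_const fun x hx =>
      (hball _ (hmem x (uIoc_subset_uIcc hx))).1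
  refine ((hrest.add hlin).congr_deriv (zero_add _)).congr_of_eventuallyEq (.of_forall fun t => ?_)
  simp

/-- The Leibniz rule for an integral with a moving upper endpoint. -/
lemma hasDerivAt_intervalIntegral_leibniz {F : ℝ × ℝ → ℝ} {U : Set (ℝ × ℝ)}
    (hU : IsOpen U) (hF : ContDiffOn ℝ 1 F U) {g : ℝ → ℝ} {g' a t₀ : ℝ}
    (hg : HasDerivAt g g' t₀) (hmem : ∀ᶠ t in 𝓝 t₀, ∀ x ∈ uIcc a (g t), (x, t) ∈ U) :
    HasDerivAt (fun t => ∫ x in a..(g t), F (x, t))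
      ((∫ x in a..(g t₀), fderiv ℝ F (x, t₀) (0, 1)) + g' * F (g t₀, t₀)) t₀ := by
  have hfix := hasDerivAt_intervalIntegral_of_contDiffOn hU hF hmem.self_of_nhds
  have hend := hasDerivAt_intervalIntegral_moving_endpoint (F := F) hg <| by
    filter_upwards [hU.mem_nhds (hmem.self_of_nhds _ right_mem_uIcc)] with p hp
    exact hF.continuousOn.continuousAt (hU.mem_nhds hp)
  obtain ⟨A, B, -, hB, hA', hB', hAB⟩ := generalized_tube_lemma
    (isCompact_uIcc (a := a) (b := g t₀)) (isCompact_singleton (x := t₀)) hU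
    (by rintro ⟨x, t⟩ ⟨hx, rfl⟩; exact hmem.self_of_nhds x hx)
  refine (hfix.add hend).congr_of_eventuallyEq ?_
  filter_upwards [hmem, hB.mem_nhds (hB' rfl)] with t ht htB
  have hintegrable : ∀ c, (∀ x ∈ uIcc a c, (x, t) ∈ U) →
      IntervalIntegrable (fun x => F (x, t)) volume a c := fun c hc =>
    (hF.continuousOn.comp (by fun_prop) hc).intervalIntegrable
  have hi₀ := hintegrable (g t₀) fun x hx => hAB ⟨hA' hx, htB⟩
  exact (intervalIntegral.integral_add_adjacent_intervals hi₀ (hi₀.symm.trans (hintegrable _ ht))).symm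

theorem undamped_energy_derivative
    (ℓ ℓ' : ℝ → ℝ)
    (hℓC1 : ContDiffOn ℝ 1 ℓ (Set.Ici 0))
    (hℓd : ∀ t ∈ Set.Ici (0:ℝ), HasDerivWithinAt ℓ (ℓ' t) (Set.Ici 0) t)
    (hℓpos : ∀ t ∈ Set.Ici (0:ℝ), 0 < ℓ t)
    (hℓspeed : ∀ t ∈ Set.Ici (0:ℝ), |ℓ' t| < 1)
    (u : ℝ → ℝ → ℝ) (U : Set (ℝ × ℝ)) (hUopen : IsOpen U)
    (hUK : {p : ℝ × ℝ | 0 ≤ p.2 ∧ p.1 ∈ Set.Icc 0 (ℓ p.2)} ⊆ U)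
    (huC2 : ContDiffOn ℝ 2 (fun p : ℝ × ℝ => u p.1 p.2) U)
    (hwave : ∀ x t : ℝ, 0 ≤ t → x ∈ Set.Icc 0 (ℓ t) →
      deriv (deriv (u x)) t = deriv (deriv (fun y => u y t)) x)
    (hbc0 : ∀ t : ℝ, 0 ≤ t → u 0 t = 0)
    (hbcℓ : ∀ t : ℝ, 0 < t →
      deriv (fun y => u y t) (ℓ t) + ℓ' t * deriv (u (ℓ t)) t = 0)
    (E : ℝ → ℝ)
    (hE : ∀ t : ℝ, E t = (1/2) * ∫ x in (0:ℝ)..(ℓ t),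
      ((deriv (u x) t)^2 + (deriv (fun y => u y t) x)^2))
    : ∀ t : ℝ, 0 < t → HasDerivAt E
      (-(ℓ' t / 2) * (1 - |ℓ' t|^2) * (deriv (u (ℓ t)) t)^2) t := by
  intro t₀ ht₀
  set w : ℝ × ℝ → ℝ := fun p => u p.1 p.2
  set P : ℝ × ℝ → ℝ := fun p => fderiv ℝ w p (0, 1) with hP
  set Q : ℝ × ℝ → ℝ := fun p => fderiv ℝ w p (1, 0) with hQ
  have hfd : ContDiffOn ℝ 1 (fderiv ℝ w) U := huC2.fderiv_of_isOpen hUopen (by norm_num)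
  have hP1 : ContDiffOn ℝ 1 P U := hfd.clm_apply contDiffOn_const
  have hQ1 : ContDiffOn ℝ 1 Q U := hfd.clm_apply contDiffOn_const
  have hdiff : ∀ {G : ℝ × ℝ → ℝ}, ContDiffOn ℝ 1 G U → ∀ p ∈ U, DifferentiableAt ℝ G p :=
    fun hG p hp => (hG.contDiffAt (hUopen.mem_nhds hp)).differentiableAt one_ne_zero
  have hw1 : ContDiffOn ℝ 1 w U := huC2.of_le one_le_two
  have hut : ∀ x t, (x, t) ∈ U → deriv (u x) t = P (x, t) := fun x t h =>
    (hdiff hw1 _ h).hasDerivAt_slice_snd.deriv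
  have hux : ∀ x t, (x, t) ∈ U → deriv (fun y => u y t) x = Q (x, t) := fun x t h =>
    (hdiff hw1 _ h).hasDerivAt_slice_fst.deriv
  have hutt : ∀ x t, (x, t) ∈ U → deriv (deriv (u x)) t = fderiv ℝ P (x, t) (0, 1) := by
    intro x t h
    have hev : deriv (u x) =ᶠ[𝓝 t] fun s => P (x, s) := by
      filter_upwards [(hUopen.preimage (by fun_prop : Continuous fun s : ℝ => (x, s))).mem_nhds h]
        with s hs using hut x s hs
    rw [hev.deriv_eq, (hdiff hP1 _ h).hasDerivAt_slice_snd.deriv]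
  have huxx : ∀ x t, (x, t) ∈ U →
      deriv (deriv (fun y => u y t)) x = fderiv ℝ Q (x, t) (1, 0) := by
    intro x t h
    have hev : deriv (fun y => u y t) =ᶠ[𝓝 x] fun y => Q (y, t) := by
      filter_upwards [(hUopen.preimage (by fun_prop : Continuous fun y : ℝ => (y, t))).mem_nhds h]
        with y hy using hux y t hy
    rw [hev.deriv_eq, (hdiff hQ1 _ h).hasDerivAt_slice_fst.deriv]
  have hsymm : ∀ p ∈ U, fderiv ℝ P p (1, 0) = fderiv ℝ Q p (0, 1) := by
    intro p hp
    have hd : DifferentiableAt ℝ (fderiv ℝ w) p :=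
      (hfd.contDiffAt (hUopen.mem_nhds hp)).differentiableAt one_ne_zero
    have hs := (huC2.contDiffAt (hUopen.mem_nhds hp)).isSymmSndFDerivAt (by simp)
    have happly : ∀ v z : ℝ × ℝ,
        fderiv ℝ (fun q => fderiv ℝ w q v) p z = fderiv ℝ (fderiv ℝ w) p z v := fun v z => by
      simp [fderiv_clm_apply hd (differentiableAt_const v)]
    rw [hP, hQ, happly, happly]
    exact hs.eq _ _
  have hKU : ∀ x t, 0 ≤ t → x ∈ uIcc 0 (ℓ t) → (x, t) ∈ U := fun x t ht hx =>
    hUK ⟨ht, by rwa [uIcc_of_le (hℓpos t ht).le] at hx⟩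
  have hℓt : HasDerivAt ℓ (ℓ' t₀) t₀ := (hℓd t₀ ht₀.le).hasDerivAt (Ici_mem_nhds ht₀)
  have hnonneg : ∀ᶠ t in 𝓝 t₀, 0 ≤ t := Ici_mem_nhds ht₀
  have hF : ContDiffOn ℝ 1 (fun p => P p ^ 2 + Q p ^ 2) U := (hP1.pow 2).add (hQ1.pow 2)
  have hleib := (hasDerivAt_intervalIntegral_leibniz hUopen hF (a := 0) hℓt
    (hnonneg.mono fun t ht x => hKU x t ht)).const_mul (1 / 2)
  have hflux : ∀ x ∈ uIcc 0 (ℓ t₀), HasDerivAt (fun y => 2 * (P (y, t₀) * Q (y, t₀)))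
      (fderiv ℝ (fun p => P p ^ 2 + Q p ^ 2) (x, t₀) (0, 1)) x := by
    intro x hx
    have hxU := hKU x t₀ ht₀.le hx
    have hPd := hdiff hP1 _ hxU
    have hQd := hdiff hQ1 _ hxU
    have hwv : fderiv ℝ P (x, t₀) (0, 1) = fderiv ℝ Q (x, t₀) (1, 0) := by
      rw [← hutt x t₀ hxU, ← huxx x t₀ hxU]
      exact hwave x t₀ ht₀.le (by rwa [uIcc_of_le (hℓpos t₀ ht₀.le).le] at hx)
    have hFt := ((hPd.hasDerivAt_slice_snd.pow 2).add (hQd.hasDerivAt_slice_snd.pow 2)).unique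
      (hdiff hF _ hxU).hasDerivAt_slice_snd
    refine ((hPd.hasDerivAt_slice_fst.mul hQd.hasDerivAt_slice_fst).const_mul 2).congr_deriv ?_
    rw [← hFt, hwv, hsymm _ hxU]
    push_cast
    ring
  have hintegrable : IntervalIntegrable
      (fun x => fderiv ℝ (fun p => P p ^ 2 + Q p ^ 2) (x, t₀) (0, 1)) volume 0 (ℓ t₀) :=
    (((hF.continuousOn_fderiv_of_isOpen hUopen le_rfl).clm_apply continuousOn_const).comp
      (f := fun x : ℝ => (x, t₀)) (by fun_prop) fun x => hKU x t₀ ht₀.le).intervalIntegrable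
  have hPzero : P (0, t₀) = 0 := by
    rw [← hut 0 t₀ (hKU 0 t₀ ht₀.le left_mem_uIcc)]
    have hev : u 0 =ᶠ[𝓝 t₀] fun _ => 0 := hnonneg.mono hbc0
    rw [hev.deriv_eq, deriv_const]
  have hend := hKU (ℓ t₀) t₀ ht₀.le right_mem_uIcc
  have hbc := hbcℓ t₀ ht₀
  rw [hux _ _ hend, hut _ _ hend] at hbc
  rw [intervalIntegral.integral_eq_sub_of_hasDerivAt hflux hintegrable, hPzero,
    eq_neg_of_add_eq_zero_left hbc] at hleib
  rw [hut _ _ hend, sq_abs]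
  refine (hleib.congr_of_eventuallyEq ?_).congr_deriv (by ring)
  filter_upwards [hnonneg] with t ht
  rw [hE t]
  congr 1
  refine intervalIntegral.integral_congr fun x hx => ?_
  simp only [hut x t (hKU x t ht hx), hux x t (hKU x t ht hx)]
end

section
/- Let u be a classical solution of the wave equation on 0 < x < ℓ(t) with u(0,t) = 0 and the undamped boundary condition u_x(ℓ(t),t) + ℓ′(t) u_t(ℓ(t),t) = 0, and let φ satisfy Moore's equation φ(t+ℓ(t)) − φ(t−ℓ(t)) = 2 with φ′ > 0. Then the quantity Q(t) = ∫₀^{ℓ(t)} [ (1/φ′(t+x) + 1/φ′(t−x))(u_x² + u_t²) + 2(1/φ′(t+x) − 1/φ′(t−x)) u_x u_t ] dx is independent of t, i.e. Q(t) = Q(0) for all t ≥ 0. -/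
/-- The partial derivative in the first variable as a value of the Fréchet derivative. -/
lemma hasDerivAt_partial_fst {E : Type*} [NormedAddCommGroup E] [NormedSpace ℝ E]
    {g : ℝ × ℝ → E} {x t : ℝ} (hg : DifferentiableAt ℝ g (x, t)) :
    HasDerivAt (fun y => g (y, t)) (fderiv ℝ g (x, t) (1, 0)) x :=
  hg.hasFDerivAt.comp_hasDerivAt x ((hasDerivAt_id x).prodMk (hasDerivAt_const x t))

/-- The partial derivative in the second variable as a value of the Fréchet derivative. -/
lemma hasDerivAt_partial_snd {E : Type*} [NormedAddCommGroup E] [NormedSpace ℝ E]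
    {g : ℝ × ℝ → E} {x t : ℝ} (hg : DifferentiableAt ℝ g (x, t)) :
    HasDerivAt (fun s => g (x, s)) (fderiv ℝ g (x, t) (0, 1)) t :=
  hg.hasFDerivAt.comp_hasDerivAt t ((hasDerivAt_const t x).prodMk (hasDerivAt_id t))

/-- A pure second partial derivative in the first variable. -/
lemma deriv_deriv_partial_fst {f : ℝ × ℝ → ℝ} {U : Set (ℝ × ℝ)} (hU : IsOpen U)
    (hf : ContDiffOn ℝ 2 f U) {x t : ℝ} (hx : (x, t) ∈ U) :
    deriv (deriv fun y => f (y, t)) x = fderiv ℝ (fderiv ℝ f) (x, t) (1, 0) (1, 0) := by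
  have hD : ContDiffOn ℝ 1 (fderiv ℝ f) U := hf.fderiv_of_isOpen hU (by norm_num)
  have hev : (deriv fun y => f (y, t)) =ᶠ[nhds x] fun y => fderiv ℝ f (y, t) (1, 0) := by
    have hc : ContinuousAt (fun y : ℝ => (y, t)) x := by fun_prop
    filter_upwards [hc.preimage_mem_nhds (hU.mem_nhds hx)] with y hy
    exact (hasDerivAt_partial_fst
      ((hf.contDiffAt (hU.mem_nhds hy)).differentiableAt (by norm_num))).deriv
  rw [hev.deriv_eq]
  have h := hasDerivAt_partial_fst
    ((hD.contDiffAt (hU.mem_nhds hx)).differentiableAt (by norm_num))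
  exact (h.clm_apply (hasDerivAt_const x ((1 : ℝ), (0 : ℝ)))).deriv.trans (by simp)

/-- A pure second partial derivative in the second variable. -/
lemma deriv_deriv_partial_snd {f : ℝ × ℝ → ℝ} {U : Set (ℝ × ℝ)} (hU : IsOpen U)
    (hf : ContDiffOn ℝ 2 f U) {x t : ℝ} (hx : (x, t) ∈ U) :
    deriv (deriv fun s => f (x, s)) t = fderiv ℝ (fderiv ℝ f) (x, t) (0, 1) (0, 1) := by
  have hD : ContDiffOn ℝ 1 (fderiv ℝ f) U := hf.fderiv_of_isOpen hU (by norm_num)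
  have hev : (deriv fun s => f (x, s)) =ᶠ[nhds t] fun s => fderiv ℝ f (x, s) (0, 1) := by
    have hc : ContinuousAt (fun s : ℝ => (x, s)) t := by fun_prop
    filter_upwards [hc.preimage_mem_nhds (hU.mem_nhds hx)] with s hs
    exact (hasDerivAt_partial_snd
      ((hf.contDiffAt (hU.mem_nhds hs)).differentiableAt (by norm_num))).deriv
  rw [hev.deriv_eq]
  have h := hasDerivAt_partial_snd
    ((hD.contDiffAt (hU.mem_nhds hx)).differentiableAt (by norm_num))
  exact (h.clm_apply (hasDerivAt_const t ((0 : ℝ), (1 : ℝ)))).deriv.trans (by simp)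

/-- For a solution of the wave equation, the derivative in a characteristic direction `(1, σ)`,
`σ = ±1`, is constant along the characteristic with velocity `(-1, σ)`. -/
lemma fderiv_eq_along_characteristic {f : ℝ × ℝ → ℝ} {U : Set (ℝ × ℝ)} (hU : IsOpen U)
    (hf : ContDiffOn ℝ 2 f U) {σ : ℝ} (hσ : σ * σ = 1) {x t b : ℝ} (hb : 0 ≤ b)
    (hmem : ∀ h ∈ Set.Icc 0 b, (x - h, t + σ * h) ∈ U)
    (hwave : ∀ h ∈ Set.Icc 0 b, fderiv ℝ (fderiv ℝ f) (x - h, t + σ * h) (1, 0) (1, 0)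
      = fderiv ℝ (fderiv ℝ f) (x - h, t + σ * h) (0, 1) (0, 1)) :
    fderiv ℝ f (x - b, t + σ * b) (1, σ) = fderiv ℝ f (x, t) (1, σ) := by
  have hD : ContDiffOn ℝ 1 (fderiv ℝ f) U := hf.fderiv_of_isOpen hU (by norm_num)
  have key : ∀ h ∈ Set.Icc 0 b,
      HasDerivAt (fun h => fderiv ℝ f (x - h, t + σ * h) (1, σ)) 0 h := by
    intro h hh
    have hm := hU.mem_nhds (hmem h hh)
    have hd := ((hD.contDiffAt hm).differentiableAt (by norm_num)).hasFDerivAt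
    have hfst : HasDerivAt (fun h : ℝ => x - h) (-1) h := (hasDerivAt_id' h).const_sub x
    have hsnd : HasDerivAt (fun h : ℝ => t + σ * h) σ h := by
      simpa using ((hasDerivAt_id' h).const_mul σ).const_add t
    have hcurve : HasDerivAt (fun h : ℝ => (x - h, t + σ * h)) (-1, σ) h := hfst.prodMk hsnd
    have hcomp : HasDerivAt (fun h => fderiv ℝ f (x - h, t + σ * h))
        (fderiv ℝ (fderiv ℝ f) (x - h, t + σ * h) (-1, σ)) h :=
      hd.comp_hasDerivAt (f := fun h : ℝ => (x - h, t + σ * h)) h hcurve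
    have h1 := hcomp.clm_apply (hasDerivAt_const h ((1 : ℝ), σ))
    have hsymm := ((hf.contDiffAt hm).isSymmSndFDerivAt (by simp)).eq (1, 0) (0, 1)
    have hw := hwave h hh
    refine h1.congr_deriv ?_
    have e1 : ((-1 : ℝ), σ) = (-1 : ℝ) • ((1 : ℝ), (0 : ℝ)) + σ • ((0 : ℝ), (1 : ℝ)) := by simp
    have e2 : ((1 : ℝ), σ) = ((1 : ℝ), (0 : ℝ)) + σ • ((0 : ℝ), (1 : ℝ)) := by simp
    rw [e1, e2]
    simp only [map_add, map_smul, add_apply, smul_apply,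
      smul_eq_mul, map_zero, add_zero]
    rw [hw, hsymm]
    linear_combination
      fderiv ℝ (fderiv ℝ f) (x - h, t + σ * h) (0, 1) (0, 1) * hσ
  have := constant_of_has_deriv_right_zero (fun h hh => (key h hh).continuousAt.continuousWithinAt)
    (fun h hh => (key h (Set.Ico_subset_Icc_self hh)).hasDerivWithinAt) b ⟨hb, le_rfl⟩
  simpa using this

/-- A function on `[0, ∞)` with derivative bounded by one is `1`-Lipschitz. -/
lemma abs_sub_le_of_abs_deriv_lt_one {ℓ ℓ' : ℝ → ℝ}
    (hd : ∀ t ∈ Set.Ici (0 : ℝ), HasDerivWithinAt ℓ (ℓ' t) (Set.Ici 0) t)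
    (hs : ∀ t ∈ Set.Ici (0 : ℝ), |ℓ' t| < 1) {s t : ℝ} (h0 : 0 ≤ s) (h1 : 0 ≤ t) :
    |ℓ t - ℓ s| ≤ |t - s| := by
  simpa using (convex_Ici (0 : ℝ)).norm_image_sub_le_of_norm_hasDerivWithin_le (C := 1) hd
    (fun t ht => (hs t ht).le) h0 h1

/-- The derivative of a `C¹` function on a closed half-line is continuous there. -/
lemma continuousOn_of_contDiffOn_Ici {φ φ' : ℝ → ℝ} {a : ℝ} (h : ContDiffOn ℝ 1 φ (Set.Ici a))
    (hd : ∀ s ∈ Set.Ici a, HasDerivWithinAt φ (φ' s) (Set.Ici a) s) :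
    ContinuousOn φ' (Set.Ici a) :=
  (h.continuousOn_derivWithin (uniqueDiffOn_Ici a) le_rfl).congr fun s hs =>
    ((hd s hs).derivWithin (uniqueDiffOn_Ici a s hs)).symm

/-- If `G` is continuous and `(1 + ℓ') G (t + ℓ) = (1 - ℓ') G (t - ℓ)` for `t > 0`, then the
integral of `G` over `[t - ℓ t, t + ℓ t]` does not depend on `t`. -/
lemma integral_moving_interval_eq {G ℓ ℓ' : ℝ → ℝ} (hG : Continuous G)
    (hc : ContinuousOn ℓ (Set.Ici 0)) (hd : ∀ t > 0, HasDerivAt ℓ (ℓ' t) t)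
    (hflux : ∀ t > 0, (1 + ℓ' t) * G (t + ℓ t) = (1 - ℓ' t) * G (t - ℓ t)) {t : ℝ} (ht : 0 ≤ t) :
    ∫ s in (t - ℓ t)..(t + ℓ t), G s = ∫ s in (0 - ℓ 0)..(0 + ℓ 0), G s := by
  have hH : ∀ y, HasDerivAt (fun y => ∫ s in (0 : ℝ)..y, G s) (G y) y := fun y =>
    hG.integral_hasStrictDerivAt 0 y |>.hasDerivAt
  have hsplit : ∀ a b, ∫ s in a..b, G s = (∫ s in (0 : ℝ)..b, G s) - ∫ s in (0 : ℝ)..a, G s :=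
    fun a b => (intervalIntegral.integral_interval_sub_left
      (hG.intervalIntegrable _ _) (hG.intervalIntegrable _ _)).symm
  have hHc : Continuous fun y => ∫ s in (0 : ℝ)..y, G s :=
    continuous_iff_continuousAt.2 fun y => (hH y).continuousAt
  rcases ht.eq_or_lt with rfl | ht
  · rfl
  rw [hsplit (t - ℓ t), hsplit (0 - ℓ 0)]
  have hcont : ContinuousOn (fun t => (∫ s in (0 : ℝ)..(t + ℓ t), G s)
      - ∫ s in (0 : ℝ)..(t - ℓ t), G s) (Set.Icc 0 t) := by
    have hc' : ContinuousOn ℓ (Set.Icc 0 t) := hc.mono Set.Icc_subset_Ici_self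
    exact (hHc.comp_continuousOn (continuousOn_id.add hc')).sub
      (hHc.comp_continuousOn (continuousOn_id.sub hc'))
  obtain ⟨c, -, hceq⟩ := exists_hasDerivAt_eq_slope _ (fun _ => (0 : ℝ)) ht hcont fun τ hτ => by
    have hℓ := hd τ hτ.1
    have h1 := (hH (τ + ℓ τ)).comp τ ((hasDerivAt_id τ).add hℓ)
    have h2 := (hH (τ - ℓ τ)).comp τ ((hasDerivAt_id τ).sub hℓ)
    refine (h1.sub h2).congr_deriv ?_
    linear_combination hflux τ hτ.1
  rw [eq_comm, div_eq_zero_iff] at hceq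
  rcases hceq with h | h <;> linarith

theorem undamped_conserved_quantity
    (L : ℝ) (ℓ ℓ' : ℝ → ℝ)
    (hℓC1 : ContDiffOn ℝ 1 ℓ (Set.Ici 0))
    (hℓd : ∀ t ∈ Set.Ici (0:ℝ), HasDerivWithinAt ℓ (ℓ' t) (Set.Ici 0) t)
    (hℓpos : ∀ t ∈ Set.Ici (0:ℝ), 0 < ℓ t)
    (hℓspeed : ∀ t ∈ Set.Ici (0:ℝ), |ℓ' t| < 1)
    (hL : ℓ 0 = L)
    (u : ℝ → ℝ → ℝ) (U : Set (ℝ × ℝ)) (hUopen : IsOpen U)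
    (hUK : {p : ℝ × ℝ | 0 ≤ p.2 ∧ p.1 ∈ Set.Icc 0 (ℓ p.2)} ⊆ U)
    (huC2 : ContDiffOn ℝ 2 (fun p : ℝ × ℝ => u p.1 p.2) U)
    (hwave : ∀ x t : ℝ, 0 ≤ t → x ∈ Set.Icc 0 (ℓ t) →
      deriv (deriv (u x)) t = deriv (deriv (fun y => u y t)) x)
    (hbc0 : ∀ t : ℝ, 0 ≤ t → u 0 t = 0)
    (hbcℓ : ∀ t : ℝ, 0 < t →
      deriv (fun y => u y t) (ℓ t) + ℓ' t * deriv (u (ℓ t)) t = 0)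
    (φ φ' : ℝ → ℝ)
    (hφC1 : ContDiffOn ℝ 1 φ (Set.Ici (-L)))
    (hφd : ∀ s ∈ Set.Ici (-L), HasDerivWithinAt φ (φ' s) (Set.Ici (-L)) s)
    (hφpos : ∀ s ∈ Set.Ici (-L), 0 < φ' s)
    (hMoore : ∀ t ∈ Set.Ici (0:ℝ), φ (t + ℓ t) - φ (t - ℓ t) = 2)
    (Q : ℝ → ℝ)
    (hQ : ∀ t : ℝ, Q t = ∫ x in (0:ℝ)..(ℓ t),
      ((1 / φ' (t + x) + 1 / φ' (t - x))
          * ((deriv (fun y => u y t) x)^2 + (deriv (u x) t)^2)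
        + 2 * (1 / φ' (t + x) - 1 / φ' (t - x))
          * (deriv (fun y => u y t) x * deriv (u x) t)))
    : ∀ t ∈ Set.Ici (0:ℝ), Q t = Q 0 := by
  set f : ℝ × ℝ → ℝ := fun p => u p.1 p.2
  have hmem : ∀ {x t : ℝ}, 0 ≤ t → x ∈ Set.Icc 0 (ℓ t) → (x, t) ∈ U := fun ht hx => hUK ⟨ht, hx⟩
  have hdiff : ∀ {p}, p ∈ U → DifferentiableAt ℝ f p := fun hp =>
    (huC2.contDiffAt (hUopen.mem_nhds hp)).differentiableAt (by norm_num)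
  have hDc : ContinuousOn (fderiv ℝ f) U :=
    (huC2.fderiv_of_isOpen (m := 1) hUopen (by norm_num)).continuousOn
  have hux : ∀ {x t}, (x, t) ∈ U → deriv (fun y => u y t) x = fderiv ℝ f (x, t) (1, 0) :=
    fun h => (hasDerivAt_partial_fst (hdiff h)).deriv
  have hut : ∀ {x t}, (x, t) ∈ U → deriv (u x) t = fderiv ℝ f (x, t) (0, 1) :=
    fun h => (hasDerivAt_partial_snd (hdiff h)).deriv
  have hdir : ∀ p (σ : ℝ), fderiv ℝ f p (1, σ) = fderiv ℝ f p (1, 0) + σ * fderiv ℝ f p (0, 1) := by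
    intro p σ
    have e : ((1 : ℝ), σ) = ((1 : ℝ), (0 : ℝ)) + σ • ((0 : ℝ), (1 : ℝ)) := by simp
    rw [e, map_add, map_smul, smul_eq_mul]
  have hlip : ∀ {s t : ℝ}, 0 ≤ s → 0 ≤ t → |ℓ t - ℓ s| ≤ |t - s| :=
    abs_sub_le_of_abs_deriv_lt_one hℓd hℓspeed
  have hchar : ∀ (σ : ℝ), σ * σ = 1 → ∀ {x t b : ℝ}, 0 ≤ b → b ≤ x → 0 ≤ t → 0 ≤ t + σ * b →
      x ≤ ℓ t → fderiv ℝ f (x - b, t + σ * b) (1, σ) = fderiv ℝ f (x, t) (1, σ) := by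
    intro σ hσ x t b hb hbx ht htb hx
    have hin : ∀ h ∈ Set.Icc 0 b, 0 ≤ t + σ * h ∧ x - h ∈ Set.Icc 0 (ℓ (t + σ * h)) := by
      intro h hh
      have hσ' : |σ| = 1 := by
        rcases mul_self_eq_one_iff.1 hσ with rfl | rfl <;> simp
      have h0 : 0 ≤ t + σ * h := by
        rcases mul_self_eq_one_iff.1 hσ with rfl | rfl <;> linarith [hh.1, hh.2]
      have := hlip h0 ht
      rw [show t - (t + σ * h) = -(σ * h) by ring, abs_neg, abs_mul, hσ', one_mul,
        abs_of_nonneg hh.1] at this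
      exact ⟨h0, by linarith [hh.2], by linarith [le_abs_self (ℓ t - ℓ (t + σ * h))]⟩
    refine fderiv_eq_along_characteristic hUopen huC2 hσ hb
      (fun h hh => hmem (hin h hh).1 (hin h hh).2) fun h hh => ?_
    have hm := hmem (hin h hh).1 (hin h hh).2
    rw [← deriv_deriv_partial_fst hUopen huC2 hm, ← deriv_deriv_partial_snd hUopen huC2 hm]
    exact (hwave _ _ (hin h hh).1 (hin h hh).2).symm
  have hzero : ∀ {t}, 0 ≤ t → (0 : ℝ) ∈ Set.Icc 0 (ℓ t) := fun ht => ⟨le_rfl, (hℓpos _ ht).le⟩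
  have hut0 : ∀ {t}, 0 ≤ t → fderiv ℝ f (0, t) (0, 1) = 0 := by
    intro t ht
    have h1 := (hasDerivAt_partial_snd (hdiff (hmem ht (hzero ht)))).hasDerivWithinAt
      (s := Set.Ici t)
    have h2 : HasDerivWithinAt (fun s => f (0, s)) 0 (Set.Ici t) t :=
      (hasDerivWithinAt_const t _ (0 : ℝ)).congr (fun s hs => hbc0 s (ht.trans hs)) (hbc0 t ht)
    exact (uniqueDiffOn_Ici t t Set.self_mem_Ici).eq_deriv _ h1 h2
  have hLpos : 0 < L := hL ▸ hℓpos 0 Set.self_mem_Ici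
  -- the common profile of both Riemann invariants
  let F : ℝ → ℝ := fun s => fderiv ℝ f (0, max s 0) (1, 1)
    + fderiv ℝ f (min (max (-s) 0) L, 0) (1, -1) - fderiv ℝ f (0, 0) (1, 0)
  have hFc : Continuous F := by
    have h1 : Continuous fun s : ℝ => fderiv ℝ f (0, max s 0) :=
      hDc.comp_continuous (by fun_prop) fun s => hmem (le_max_right _ _) (hzero (le_max_right _ _))
    have h2 : Continuous fun s : ℝ => fderiv ℝ f (min (max (-s) 0) L, 0) :=
      hDc.comp_continuous (by fun_prop) fun s => hmem le_rfl
        ⟨le_min (le_max_right _ _) hLpos.le, hL ▸ min_le_right _ _⟩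
    exact ((h1.clm_apply continuous_const).add (h2.clm_apply continuous_const)).sub
      continuous_const
  have hF0 : ∀ {s}, 0 ≤ s → F s = fderiv ℝ f (0, s) (1, 0) := by
    intro s hs
    have h1 : max (-s) 0 = 0 := max_eq_right (by linarith)
    simp only [F, max_eq_left hs, h1, min_eq_left hLpos.le, hdir _ 1, hdir _ (-1), hut0 hs,
      hut0 le_rfl]
    ring
  have hFneg : ∀ {s}, s ≤ 0 → -L ≤ s → F s = fderiv ℝ f (-s, 0) (1, -1) := by
    intro s hs hs'
    have h1 : max (-s) 0 = -s := max_eq_left (by linarith)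
    simp only [F, max_eq_right hs, h1, min_eq_left (neg_le.1 hs'), hdir _ 1, hut0 le_rfl]
    ring
  have hbd : ∀ {x t}, 0 ≤ t → x ∈ Set.Icc 0 (ℓ t) → -L ≤ t - x := by
    intro x t ht hx
    have := hlip le_rfl ht
    rw [hL, sub_zero, abs_of_nonneg ht] at this
    linarith [hx.2, le_abs_self (ℓ t - L)]
  have hp : ∀ {x t}, 0 ≤ t → x ∈ Set.Icc 0 (ℓ t) →
      F (t + x) = fderiv ℝ f (x, t) (1, 1) := by
    intro x t ht hx
    have htx : 0 ≤ t + x := add_nonneg ht hx.1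
    have := hchar 1 (by norm_num) hx.1 le_rfl ht (by linarith) hx.2
    rw [← this, sub_self, one_mul, hF0 htx, hdir _ 1, hut0 htx]
    ring
  have hq : ∀ {x t}, 0 ≤ t → x ∈ Set.Icc 0 (ℓ t) →
      F (t - x) = fderiv ℝ f (x, t) (1, -1) := by
    intro x t ht hx
    rcases le_total x t with hxt | hxt
    · have htx : 0 ≤ t - x := sub_nonneg.2 hxt
      have := hchar (-1) (by norm_num) hx.1 le_rfl ht (by linarith) hx.2
      rw [← this, sub_self, neg_one_mul, ← sub_eq_add_neg, hF0 htx, hdir _ (-1), hut0 htx]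
      ring
    · have := hchar (-1) (by norm_num) ht hxt ht (by linarith) hx.2
      rw [← this, hFneg (by linarith) (hbd ht hx), neg_one_mul, add_neg_cancel, neg_sub]
  have hφc : Continuous fun s => φ' (max s (-L)) :=
    (continuousOn_of_contDiffOn_Ici hφC1 hφd).comp_continuous (by fun_prop)
      fun s => Set.mem_Ici.2 (le_max_right _ _)
  let G : ℝ → ℝ := fun s => F s ^ 2 / φ' (max s (-L))
  have hGc : Continuous G := (hFc.pow 2).div hφc fun s => (hφpos _ (Set.mem_Ici.2 (le_max_right _ _))).ne'
  have hG : ∀ {s}, -L ≤ s → G s = F s ^ 2 / φ' s := fun hs => by simp only [G, max_eq_left hs]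
  have hQG : ∀ {t}, 0 ≤ t → Q t = ∫ s in (t - ℓ t)..(t + ℓ t), G s := by
    intro t ht
    have hpt : Set.EqOn (fun x => (1 / φ' (t + x) + 1 / φ' (t - x))
          * ((deriv (fun y => u y t) x)^2 + (deriv (u x) t)^2)
        + 2 * (1 / φ' (t + x) - 1 / φ' (t - x)) * (deriv (fun y => u y t) x * deriv (u x) t))
        (fun x => G (t + x) + G (t - x)) (Set.uIcc 0 (ℓ t)) := by
      intro x hx
      rw [Set.uIcc_of_le (hℓpos t ht).le] at hx
      have hm := hmem ht hx
      simp only [hux hm, hut hm]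
      rw [hG (by linarith [hx.1] : -L ≤ t + x), hG (hbd ht hx), hp ht hx, hq ht hx, hdir _ 1,
        hdir _ (-1)]
      ring
    rw [hQ, intervalIntegral.integral_congr hpt, intervalIntegral.integral_add
      (Continuous.intervalIntegrable (by fun_prop) _ _)
      (Continuous.intervalIntegrable (by fun_prop) _ _),
      intervalIntegral.integral_comp_add_left G, intervalIntegral.integral_comp_sub_left G,
      add_zero, sub_zero, add_comm,
      intervalIntegral.integral_add_adjacent_intervals (hGc.intervalIntegrable _ _)
        (hGc.intervalIntegrable _ _)]
  intro t ht
  have hℓd' : ∀ t > 0, HasDerivAt ℓ (ℓ' t) t := fun t ht =>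
    (hℓd t ht.le).hasDerivAt (Ici_mem_nhds ht)
  rw [hQG ht, hQG le_rfl]
  refine integral_moving_interval_eq hGc hℓC1.continuousOn hℓd' (fun τ hτ => ?_) ht
  have hτ0 : 0 ≤ τ := le_of_lt hτ
  have hend : ℓ τ ∈ Set.Icc 0 (ℓ τ) := ⟨(hℓpos τ hτ0).le, le_rfl⟩
  have hm := hmem hτ0 hend
  have hmaps1 : -L < τ + ℓ τ := by linarith [hend.1]
  have hmaps2 : -L ≤ τ - ℓ τ := hbd hτ0 hend
  have hflow : (1 + ℓ' τ) * φ' (τ + ℓ τ) = (1 - ℓ' τ) * φ' (τ - ℓ τ) := by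
    have hI : UniqueDiffWithinAt ℝ (Set.Ici (0 : ℝ)) τ := uniqueDiffOn_Ici 0 τ hτ0
    have h1 := (hφd _ hmaps1.le).comp τ ((hasDerivWithinAt_id τ (Set.Ici 0)).add (hℓd τ hτ0))
      fun s hs => by
        have := (hℓpos s hs).le
        have hs' : 0 ≤ s := hs
        simp only [Set.mem_Ici, Pi.add_apply, id_eq]
        linarith
    have h2 := (hφd _ hmaps2).comp τ ((hasDerivWithinAt_id τ (Set.Ici 0)).sub (hℓd τ hτ0))
      fun s hs => hbd hs ⟨(hℓpos s hs).le, le_rfl⟩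
    have h3 : HasDerivWithinAt (fun s => φ (s + ℓ s) - φ (s - ℓ s)) 0 (Set.Ici 0) τ :=
      (hasDerivWithinAt_const τ _ (2 : ℝ)).congr hMoore (hMoore τ hτ0)
    have := hI.eq_deriv _ (h1.sub h2) h3
    linear_combination this
  have hbc := hbcℓ τ hτ
  rw [hux hm, hut hm] at hbc
  rw [hG hmaps1.le, hG hmaps2, hp hτ0 hend, hq hτ0 hend, hdir _ 1, hdir _ (-1)]
  have hP := hφpos _ hmaps1.le
  have hM := hφpos _ hmaps2
  have hs := abs_lt.1 (hℓspeed τ hτ0)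
  generalize fderiv ℝ f (ℓ τ, τ) (1, 0) = a at *
  generalize fderiv ℝ f (ℓ τ, τ) (0, 1) = b at *
  generalize φ' (τ + ℓ τ) = A at *
  generalize φ' (τ - ℓ τ) = B at *
  generalize ℓ' τ = v at *
  have hv : 1 - v ≠ 0 := by linarith
  have ha : a = -(v * b) := by linarith
  have hB : B = (1 + v) * A / (1 - v) := by field_simp; linarith
  have hv' : 1 + v ≠ 0 := by linarith
  subst ha hB
  field_simp
  ring
end

section
/- Let u be a classical solution of the wave equation on 0 < x < ℓ(t) with u(0,t) = 0 and the undamped boundary condition u_x(ℓ(t),t) + ℓ′(t) u_t(ℓ(t),t) = 0, and let φ satisfy Moore's equation with φ′ > 0. Define m(t) = min over x ∈ [0,ℓ(t)] of {φ′(t−x), φ′(t+x)} and M(t) = max over x ∈ [0,ℓ(t)] of {φ′(t−x), φ′(t+x)}. Then for all 0 ≤ t₀ < t, (m(t)/M(t₀)) E(t₀) ≤ E(t) ≤ (M(t)/m(t₀)) E(t₀). -/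
open Set MeasureTheory

section SecondDerivatives

variable {V : Type*} [NormedAddCommGroup V] [NormedSpace ℝ V]

/-- The second derivative of a `C²` function along a line of direction `d`. -/
theorem deriv_deriv_comp_line {f : V → ℝ} {γ : ℝ → V} {d : V} {t : ℝ}
    (hf : ContDiffAt ℝ 2 f (γ t)) (hγ : ∀ s, HasDerivAt γ d s) :
    deriv (deriv fun s => f (γ s)) t = fderiv ℝ (fderiv ℝ f) (γ t) d d := by
  have hev : deriv (fun s => f (γ s)) =ᶠ[nhds t] fun s => fderiv ℝ f (γ s) d := by
    filter_upwards [(hγ t).continuousAt.eventually (hf.eventually (by simp))] with s hs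
    exact ((hs.differentiableAt (by simp)).hasFDerivAt.comp_hasDerivAt s (hγ s)).deriv
  rw [hev.deriv_eq]
  have h1 : DifferentiableAt ℝ (fderiv ℝ f) (γ t) :=
    (hf.fderiv_right (m := 1) (by norm_num)).differentiableAt (by simp)
  have h2 := h1.hasFDerivAt.comp_hasDerivAt t (hγ t)
  simpa using (h2.clm_apply (hasDerivAt_const t d)).deriv

/-- If the mixed second derivative in the directions `d`, `e` vanishes along a segment of
direction `d`, then the derivative in the direction `e` is constant on that segment. -/
theorem fderiv_apply_eq_of_segment {f : V → ℝ} {p d e : V} {R : ℝ} (hR : 0 ≤ R)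
    (hf : ∀ r ∈ Icc 0 R, ContDiffAt ℝ 2 f (p + r • d))
    (h0 : ∀ r ∈ Icc 0 R, fderiv ℝ (fderiv ℝ f) (p + r • d) d e = 0) :
    fderiv ℝ f (p + R • d) e = fderiv ℝ f p e := by
  have hder : ∀ r ∈ Icc 0 R, HasDerivAt (fun r => fderiv ℝ f (p + r • d) e) 0 r := by
    intro r hr
    have hγ : HasDerivAt (fun r : ℝ => p + r • d) d r := by
      simpa using ((hasDerivAt_id r).smul_const d).const_add p
    have h1 : DifferentiableAt ℝ (fderiv ℝ f) (p + r • d) :=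
      ((hf r hr).fderiv_right (m := 1) (by norm_num)).differentiableAt (by simp)
    have h2 := h1.hasFDerivAt.comp_hasDerivAt r hγ
    simpa [h0 r hr] using h2.clm_apply (hasDerivAt_const r e)
  have := constant_of_has_deriv_right_zero
    (fun r hr => (hder r hr).continuousAt.continuousWithinAt)
    (fun r hr => (hder r (Ico_subset_Icc_self hr)).hasDerivWithinAt) R (right_mem_Icc.2 hR)
  simpa using this

end SecondDerivatives

section WaveEquation

variable {u : ℝ → ℝ → ℝ} {x t : ℝ}

theorem deriv_time_eq_fderiv
    (hu : DifferentiableAt ℝ (fun p : ℝ × ℝ => u p.1 p.2) (x, t)) :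
    deriv (u x) t = fderiv ℝ (fun p : ℝ × ℝ => u p.1 p.2) (x, t) (0, 1) :=
  (hu.hasFDerivAt.comp_hasDerivAt (f := fun s => (x, s)) t
    ((hasDerivAt_const t x).prodMk (hasDerivAt_id t))).deriv

theorem deriv_space_eq_fderiv
    (hu : DifferentiableAt ℝ (fun p : ℝ × ℝ => u p.1 p.2) (x, t)) :
    deriv (fun y => u y t) x = fderiv ℝ (fun p : ℝ × ℝ => u p.1 p.2) (x, t) (1, 0) :=
  (hu.hasFDerivAt.comp_hasDerivAt (f := fun y => (y, t)) x
    ((hasDerivAt_id x).prodMk (hasDerivAt_const x t))).deriv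

/-- At a point where the wave equation holds, the mixed second derivatives in two directions
vanish as soon as the directions are conjugate for the wave operator. -/
theorem fderiv_fderiv_eq_zero_of_wave
    (hu : ContDiffAt ℝ 2 (fun p : ℝ × ℝ => u p.1 p.2) (x, t))
    (hwave : deriv (deriv (u x)) t = deriv (deriv (fun y => u y t)) x)
    {d₁ d₂ e₁ e₂ : ℝ} (h₁ : d₁ * e₁ + d₂ * e₂ = 0) (h₂ : d₁ * e₂ + d₂ * e₁ = 0) :
    fderiv ℝ (fderiv ℝ (fun p : ℝ × ℝ => u p.1 p.2)) (x, t) (d₁, d₂) (e₁, e₂) = 0 := by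
  have htt := deriv_deriv_comp_line (γ := fun s => (x, s)) hu
    (fun s => (hasDerivAt_const s x).prodMk (hasDerivAt_id s))
  have hxx := deriv_deriv_comp_line (γ := fun y => (y, t)) hu
    (fun s => (hasDerivAt_id s).prodMk (hasDerivAt_const s t))
  have hsymm : IsSymmSndFDerivAt ℝ (fun p : ℝ × ℝ => u p.1 p.2) (x, t) :=
    hu.isSymmSndFDerivAt (by simp)
  have hxt := hsymm.eq (1, 0) (0, 1)
  dsimp only at htt hxx
  have hsplit (a b : ℝ) : ((a, b) : ℝ × ℝ) = a • (1, 0) + b • (0, 1) := by simp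
  rw [hsplit d₁, hsplit e₁]
  simp only [map_add, map_smul, add_apply, smul_apply,
    smul_eq_mul]
  have heq := htt.symm.trans (hwave.trans hxx)
  rw [heq, hxt]
  linear_combination
    fderiv ℝ (fderiv ℝ (fun p : ℝ × ℝ => u p.1 p.2)) (x, t) (1, 0) (1, 0) * h₁ +
    fderiv ℝ (fderiv ℝ (fun p : ℝ × ℝ => u p.1 p.2)) (x, t) (0, 1) (1, 0) * h₂

/-- A classical solution of the wave equation which vanishes at `x = 0` has Riemann invariants
`u_t + u_x` and `u_x - u_t` given by one function of `t + x` and `t - x` respectively. -/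
theorem exists_riemann_invariant {ℓ : ℝ → ℝ} {U : Set (ℝ × ℝ)} (hUopen : IsOpen U)
    (hℓ0 : ∀ t, 0 ≤ t → 0 ≤ ℓ t)
    (hℓ : ∀ s t, 0 ≤ s → s ≤ t → |ℓ t - ℓ s| ≤ t - s)
    (hUK : {p : ℝ × ℝ | 0 ≤ p.2 ∧ p.1 ∈ Icc 0 (ℓ p.2)} ⊆ U)
    (hu : ContDiffOn ℝ 2 (fun p : ℝ × ℝ => u p.1 p.2) U)
    (hwave : ∀ x t : ℝ, 0 ≤ t → x ∈ Icc 0 (ℓ t) →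
      deriv (deriv (u x)) t = deriv (deriv (fun y => u y t)) x)
    (hbc : ∀ t : ℝ, 0 ≤ t → u 0 t = 0) :
    ∃ F : ℝ → ℝ, ContinuousOn F (Ici (-ℓ 0)) ∧ ∀ x t, 0 ≤ t → x ∈ Icc 0 (ℓ t) →
      deriv (u x) t + deriv (fun y => u y t) x = F (t + x) ∧
      deriv (fun y => u y t) x - deriv (u x) t = F (t - x) := by
  set f : ℝ × ℝ → ℝ := fun p => u p.1 p.2 with hf
  have hC2 : ∀ x t, 0 ≤ t → x ∈ Icc 0 (ℓ t) → ContDiffAt ℝ 2 f (x, t) := fun x t ht hx =>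
    hu.contDiffAt (hUopen.mem_nhds (hUK ⟨ht, hx⟩))
  have hdiff : ∀ x t, 0 ≤ t → x ∈ Icc 0 (ℓ t) → DifferentiableAt ℝ f (x, t) :=
    fun x t ht hx => (hC2 x t ht hx).differentiableAt (by simp)
  have hsplit (a b : ℝ) : ((a, b) : ℝ × ℝ) = a • (1, 0) + b • (0, 1) := by simp
  have hzero : ∀ t, 0 ≤ t → fderiv ℝ f (0, t) (0, 1) = 0 := by
    intro t ht
    have h0 := (hdiff 0 t ht ⟨le_rfl, hℓ0 t ht⟩).hasFDerivAt.comp_hasDerivAt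
      (f := fun s => ((0 : ℝ), s)) t ((hasDerivAt_const t (0 : ℝ)).prodMk (hasDerivAt_id t))
    have h1 : HasDerivWithinAt (fun s => f (0, s)) 0 (Ici 0) t :=
      (hasDerivWithinAt_const t (Ici 0) (0 : ℝ)).congr (fun s hs => hbc s hs) (hbc t ht)
    exact (uniqueDiffOn_Ici (0 : ℝ) t ht).eq_deriv _ h0.hasDerivWithinAt h1
  -- `ρ s` is the point where the characteristic `t - x = s` enters the space-time domain
  set ρ : ℝ → ℝ × ℝ := fun s => (max (-s) 0, max s 0) with hρ
  have hρmem : ∀ s ∈ Ici (-ℓ 0), 0 ≤ max s 0 ∧ max (-s) 0 ∈ Icc 0 (ℓ (max s 0)) := by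
    intro s hs
    have hs' : -ℓ 0 ≤ s := hs
    refine ⟨le_max_right _ _, le_max_right _ _, ?_⟩
    rcases le_total s 0 with h | h
    · rw [max_eq_right h, max_eq_left (by linarith)]; linarith
    · rw [max_eq_left h, max_eq_right (by linarith)]; exact hℓ0 s h
  refine ⟨fun s => fderiv ℝ f (ρ s) (1, -1), ?_, ?_⟩
  · intro s hs
    obtain ⟨h1, h2⟩ := hρmem s hs
    have hc : ContinuousAt (fderiv ℝ f) (ρ s) :=
      ((hC2 _ _ h1 h2).fderiv_right (m := 1) (by norm_num)).continuousAt
    have hρc : ContinuousAt ρ s := by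
      apply Continuous.continuousAt
      fun_prop
    have : ContinuousAt (fun s => fderiv ℝ f (ρ s)) s :=
      ContinuousAt.comp (g := fderiv ℝ f) hc hρc
    exact (this.clm_apply continuousAt_const).continuousWithinAt
  · intro x t ht hx
    have hx0 := hx.1
    have hxl := hx.2
    rw [deriv_time_eq_fderiv (hdiff x t ht hx), deriv_space_eq_fderiv (hdiff x t ht hx), ← hf]
    beta_reduce
    constructor
    · have hmem : ∀ r ∈ Icc 0 x, 0 ≤ t + r ∧ x - r ∈ Icc 0 (ℓ (t + r)) := by
        intro r hr
        have := (abs_le.1 (hℓ t (t + r) ht (by linarith [hr.1]))).1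
        exact ⟨by linarith [hr.1], by linarith [hr.2], by linarith⟩
      have hline (r : ℝ) : ((x, t) : ℝ × ℝ) + r • (-1, 1) = (x - r, t + r) := by
        ext <;> simp [sub_eq_add_neg]
      have key := fderiv_apply_eq_of_segment (f := f) (p := (x, t)) (d := (-1, 1)) (e := (1, 1))
        hx0 (fun r hr => by rw [hline]; exact hC2 _ _ (hmem r hr).1 (hmem r hr).2)
        (fun r hr => by
          rw [hline]
          exact fderiv_fderiv_eq_zero_of_wave (hC2 _ _ (hmem r hr).1 (hmem r hr).2)
            (hwave _ _ (hmem r hr).1 (hmem r hr).2) (by norm_num) (by norm_num))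
      rw [hline, sub_self] at key
      have hρ' : ρ (t + x) = (0, t + x) := by
        simp only [hρ]
        rw [max_eq_left (a := t + x) (by linarith), max_eq_right (by linarith)]
      rw [hsplit 1 1] at key
      rw [hρ', hsplit 1 (-1)]
      simp only [map_add, map_smul, smul_eq_mul, hzero (t + x) (by linarith)] at key ⊢
      linarith
    · have hmem : ∀ r ∈ Icc 0 (min x t), 0 ≤ t - r ∧ x - r ∈ Icc 0 (ℓ (t - r)) := by
        intro r hr
        have h1 := hr.2.trans (min_le_left _ _)
        have h2 := hr.2.trans (min_le_right _ _)
        have := (abs_le.1 (hℓ (t - r) t (by linarith) (by linarith [hr.1]))).2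
        exact ⟨by linarith, by linarith, by linarith⟩
      have hline (r : ℝ) : ((x, t) : ℝ × ℝ) + r • (-1, -1) = (x - r, t - r) := by
        ext <;> simp [sub_eq_add_neg]
      have key := fderiv_apply_eq_of_segment (f := f) (p := (x, t)) (d := (-1, -1)) (e := (1, -1))
        (le_min hx0 ht) (fun r hr => by rw [hline]; exact hC2 _ _ (hmem r hr).1 (hmem r hr).2)
        (fun r hr => by
          rw [hline]
          exact fderiv_fderiv_eq_zero_of_wave (hC2 _ _ (hmem r hr).1 (hmem r hr).2)
            (hwave _ _ (hmem r hr).1 (hmem r hr).2) (by norm_num) (by norm_num))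
      have hρ' : ρ (t - x) = (x - min x t, t - min x t) := by
        simp only [hρ]
        rcases le_total x t with h | h
        · rw [max_eq_left (a := t - x) (by linarith), max_eq_right (by linarith), min_eq_left h,
            sub_self]
        · rw [max_eq_right (a := t - x) (by linarith), max_eq_left (by linarith), min_eq_right h,
            sub_self, neg_sub]
      rw [hρ', ← hline, key, hsplit 1 (-1)]
      simp only [map_add, map_smul, smul_eq_mul]
      ring

end WaveEquation

/-- If `α`, `β` take values in `[a, ∞)` and `G (α t) α' t = G (β t) β' t` for `t > 0`, then the
integral of `G` from `β t` to `α t` does not depend on `t ≥ 0`. -/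
theorem intervalIntegral_eq_of_flux_eq {a : ℝ} {G α β α' β' : ℝ → ℝ}
    (hG : ContinuousOn G (Ici a))
    (hα : ∀ t ∈ Ici (0 : ℝ), HasDerivWithinAt α (α' t) (Ici 0) t)
    (hβ : ∀ t ∈ Ici (0 : ℝ), HasDerivWithinAt β (β' t) (Ici 0) t)
    (hαa : ∀ t ∈ Ici (0 : ℝ), a ≤ α t) (hβa : ∀ t ∈ Ici (0 : ℝ), a ≤ β t)
    (hflux : ∀ t, 0 < t → G (α t) * α' t = G (β t) * β' t) {t : ℝ} (ht : 0 ≤ t) :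
    ∫ s in β t..α t, G s = ∫ s in β 0..α 0, G s := by
  have hGc : Continuous fun s => G (max s a) :=
    hG.comp_continuous (by fun_prop) fun s => le_max_right s a
  have hcongr : ∀ t ∈ Ici (0 : ℝ), ∫ s in β t..α t, G s =
      (∫ s in a..α t, G (max s a)) - ∫ s in a..β t, G (max s a) := by
    intro t ht
    rw [intervalIntegral.integral_interval_sub_left (hGc.intervalIntegrable _ _)
      (hGc.intervalIntegrable _ _)]
    refine intervalIntegral.integral_congr fun s hs => ?_
    have : a ≤ s := (le_min (hβa t ht) (hαa t ht)).trans hs.1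
    simp only [max_eq_left this]
  have hder : ∀ t ∈ Ici (0 : ℝ), HasDerivWithinAt
      (fun t => (∫ s in a..α t, G (max s a)) - ∫ s in a..β t, G (max s a))
      (G (α t) * α' t - G (β t) * β' t) (Ici 0) t := by
    intro t ht
    have h1 := (hGc.integral_hasStrictDerivAt a (α t)).hasDerivAt.comp_hasDerivWithinAt t (hα t ht)
    have h2 := (hGc.integral_hasStrictDerivAt a (β t)).hasDerivAt.comp_hasDerivWithinAt t (hβ t ht)
    rw [max_eq_left (hαa t ht)] at h1
    rw [max_eq_left (hβa t ht)] at h2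
    exact h1.sub h2
  rw [hcongr t ht, hcongr 0 self_mem_Ici]
  rcases ht.eq_or_lt with rfl | htpos
  · rfl
  have hcont : ContinuousOn
      (fun t => (∫ s in a..α t, G (max s a)) - ∫ s in a..β t, G (max s a)) (Icc 0 t) :=
    fun s hs => (hder s hs.1).continuousWithinAt.mono Icc_subset_Ici_self
  obtain ⟨c, hc, hslope⟩ := exists_hasDerivAt_eq_slope _ _ htpos hcont
    fun s hs => (hder s hs.1.le).hasDerivAt (Ici_mem_nhds hs.1)
  rw [hflux c hc.1, sub_self, eq_comm, div_eq_zero_iff] at hslope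
  rcases hslope with h | h
  · exact sub_eq_zero.1 h
  · linarith

/-- The integral over `[0, l]` of the even part of a function about `t`. -/
theorem integral_add_comp_add_sub {H : ℝ → ℝ} {t l : ℝ} (hl : 0 ≤ l)
    (hH : ContinuousOn H (Icc (t - l) (t + l))) :
    ∫ x in (0 : ℝ)..l, (H (t + x) + H (t - x)) = ∫ s in (t - l)..(t + l), H s := by
  have hi : IntervalIntegrable H volume (t - l) (t + l) :=
    (hH.mono (by rw [uIcc_of_le (by linarith)])).intervalIntegrable
  have h1 : IntervalIntegrable (fun x => H (t + x)) volume 0 l := by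
    refine ContinuousOn.intervalIntegrable (hH.comp (by fun_prop) fun x hx => ?_)
    rw [uIcc_of_le hl] at hx
    exact ⟨by linarith [hx.1], by linarith [hx.2]⟩
  have h2 : IntervalIntegrable (fun x => H (t - x)) volume 0 l := by
    refine ContinuousOn.intervalIntegrable (hH.comp (by fun_prop) fun x hx => ?_)
    rw [uIcc_of_le hl] at hx
    exact ⟨by linarith [hx.2], by linarith [hx.1]⟩
  rw [intervalIntegral.integral_add h1 h2, intervalIntegral.integral_comp_add_left,
    intervalIntegral.integral_comp_sub_left, add_zero, sub_zero, add_comm]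
  refine intervalIntegral.integral_add_adjacent_intervals (hi.mono_set ?_) (hi.mono_set ?_) <;>
  · rw [uIcc_of_le (by linarith), uIcc_of_le (by linarith)]
    exact Icc_subset_Icc (by linarith) (by linarith)

/-- The infimum and supremum of `w` over `[t - l, t + l]`, written through the reflected
arguments `t ± x`, are positive bounds for a positive continuous `w`. -/
theorem reflected_extrema_bounds {w : ℝ → ℝ} {t l : ℝ} (hl : 0 ≤ l)
    (hw : ContinuousOn w (Icc (t - l) (t + l))) (hpos : ∀ s ∈ Icc (t - l) (t + l), 0 < w s) :
    0 < sInf ((fun x => min (w (t - x)) (w (t + x))) '' Icc 0 l) ∧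
    ∀ s ∈ Icc (t - l) (t + l),
      sInf ((fun x => min (w (t - x)) (w (t + x))) '' Icc 0 l) ≤ w s ∧
      w s ≤ sSup ((fun x => max (w (t - x)) (w (t + x))) '' Icc 0 l) := by
  have hadd : ∀ x ∈ Icc 0 l, t + x ∈ Icc (t - l) (t + l) := fun x hx =>
    ⟨by linarith [hx.1], by linarith [hx.2]⟩
  have hsub : ∀ x ∈ Icc 0 l, t - x ∈ Icc (t - l) (t + l) := fun x hx =>
    ⟨by linarith [hx.2], by linarith [hx.1]⟩
  have c1 : ContinuousOn (fun x => w (t + x)) (Icc 0 l) := hw.comp (by fun_prop) hadd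
  have c2 : ContinuousOn (fun x => w (t - x)) (Icc 0 l) := hw.comp (by fun_prop) hsub
  have kmin : IsCompact ((fun x => min (w (t - x)) (w (t + x))) '' Icc 0 l) :=
    isCompact_Icc.image_of_continuousOn (c2.inf c1)
  have kmax : IsCompact ((fun x => max (w (t - x)) (w (t + x))) '' Icc 0 l) :=
    isCompact_Icc.image_of_continuousOn (c2.sup c1)
  constructor
  · obtain ⟨x, hx, hxe⟩ := kmin.sInf_mem ((nonempty_Icc.2 hl).image _)
    rw [← hxe]
    exact lt_min (hpos _ (hsub x hx)) (hpos _ (hadd x hx))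
  · intro s hs
    have hmem : |s - t| ∈ Icc 0 l :=
      ⟨abs_nonneg _, abs_le.2 ⟨by linarith [hs.1], by linarith [hs.2]⟩⟩
    have hle := csInf_le kmin.bddBelow (mem_image_of_mem _ hmem)
    have hge := le_csSup kmax.bddAbove (mem_image_of_mem _ hmem)
    beta_reduce at hle hge
    rcases abs_choice (s - t) with h | h <;> rw [h] at hle hge
    · rw [add_sub_cancel] at hle hge
      exact ⟨hle.trans (min_le_right _ _), (le_max_right _ _).trans hge⟩
    · rw [sub_neg_eq_add, add_sub_cancel] at hle hge
      exact ⟨hle.trans (min_le_left _ _), (le_max_left _ _).trans hge⟩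

/-- Comparison of `∫ F²` with the weighted integral `∫ F² / w`. -/
theorem integral_sq_div_weight_bounds {F w : ℝ → ℝ} {a b c C : ℝ} (hab : a ≤ b)
    (hF : ContinuousOn F (Icc a b)) (hw : ContinuousOn w (Icc a b))
    (hpos : ∀ s ∈ Icc a b, 0 < w s) (hbd : ∀ s ∈ Icc a b, c ≤ w s ∧ w s ≤ C) :
    c * (∫ s in a..b, F s ^ 2 / w s) ≤ ∫ s in a..b, F s ^ 2 ∧
    ∫ s in a..b, F s ^ 2 ≤ C * ∫ s in a..b, F s ^ 2 / w s := by
  have i1 : IntervalIntegrable (fun s => F s ^ 2) volume a b :=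
    ContinuousOn.intervalIntegrable (by rw [uIcc_of_le hab]; exact hF.pow 2)
  have i2 : IntervalIntegrable (fun s => F s ^ 2 / w s) volume a b :=
    ContinuousOn.intervalIntegrable
      (by rw [uIcc_of_le hab]; exact (hF.pow 2).div hw fun s hs => (hpos s hs).ne')
  have hq : ∀ s ∈ Icc a b, F s ^ 2 = w s * (F s ^ 2 / w s) ∧ 0 ≤ F s ^ 2 / w s := fun s hs =>
    ⟨(mul_div_cancel₀ _ (hpos s hs).ne').symm, div_nonneg (sq_nonneg _) (hpos s hs).le⟩
  constructor <;> rw [← intervalIntegral.integral_const_mul]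
  · refine intervalIntegral.integral_mono_on hab (i2.const_mul c) i1 fun s hs => ?_
    obtain ⟨h1, h2⟩ := hq s hs
    exact (mul_le_mul_of_nonneg_right (hbd s hs).1 h2).trans h1.ge
  · refine intervalIntegral.integral_mono_on hab i1 (i2.const_mul C) fun s hs => ?_
    obtain ⟨h1, h2⟩ := hq s hs
    exact h1.le.trans (mul_le_mul_of_nonneg_right (hbd s hs).2 h2)

theorem undamped_energy_two_sided_estimate
    (L : ℝ) (ℓ ℓ' : ℝ → ℝ)
    (hℓC1 : ContDiffOn ℝ 1 ℓ (Set.Ici 0))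
    (hℓd : ∀ t ∈ Set.Ici (0:ℝ), HasDerivWithinAt ℓ (ℓ' t) (Set.Ici 0) t)
    (hℓpos : ∀ t ∈ Set.Ici (0:ℝ), 0 < ℓ t)
    (hℓspeed : ∀ t ∈ Set.Ici (0:ℝ), |ℓ' t| < 1)
    (hL : ℓ 0 = L)
    (u : ℝ → ℝ → ℝ) (U : Set (ℝ × ℝ)) (hUopen : IsOpen U)
    (hUK : {p : ℝ × ℝ | 0 ≤ p.2 ∧ p.1 ∈ Set.Icc 0 (ℓ p.2)} ⊆ U)
    (huC2 : ContDiffOn ℝ 2 (fun p : ℝ × ℝ => u p.1 p.2) U)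
    (hwave : ∀ x t : ℝ, 0 ≤ t → x ∈ Set.Icc 0 (ℓ t) →
      deriv (deriv (u x)) t = deriv (deriv (fun y => u y t)) x)
    (hbc0 : ∀ t : ℝ, 0 ≤ t → u 0 t = 0)
    (hbcℓ : ∀ t : ℝ, 0 < t →
      deriv (fun y => u y t) (ℓ t) + ℓ' t * deriv (u (ℓ t)) t = 0)
    (φ φ' : ℝ → ℝ)
    (hφC1 : ContDiffOn ℝ 1 φ (Set.Ici (-L)))
    (hφd : ∀ s ∈ Set.Ici (-L), HasDerivWithinAt φ (φ' s) (Set.Ici (-L)) s)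
    (hφpos : ∀ s ∈ Set.Ici (-L), 0 < φ' s)
    (hMoore : ∀ t ∈ Set.Ici (0:ℝ), φ (t + ℓ t) - φ (t - ℓ t) = 2)
    (E : ℝ → ℝ)
    (hE : ∀ t : ℝ, E t = (1/2) * ∫ x in (0:ℝ)..(ℓ t),
      ((deriv (u x) t)^2 + (deriv (fun y => u y t) x)^2))
    (m M : ℝ → ℝ)
    (hm : ∀ t : ℝ, m t = sInf ((fun x => min (φ' (t - x)) (φ' (t + x))) '' Set.Icc 0 (ℓ t)))
    (hM : ∀ t : ℝ, M t = sSup ((fun x => max (φ' (t - x)) (φ' (t + x))) '' Set.Icc 0 (ℓ t)))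
    : ∀ t₀ t : ℝ, 0 ≤ t₀ → t₀ < t →
      m t / M t₀ * E t₀ ≤ E t ∧ E t ≤ M t / m t₀ * E t₀ := by
  have hℓlip : ∀ s t, 0 ≤ s → s ≤ t → |ℓ t - ℓ s| ≤ t - s := by
    intro s t hs hst
    have h := (convex_Ici (0 : ℝ)).norm_image_sub_le_of_norm_hasDerivWithin_le hℓd
      (fun x hx => (hℓspeed x hx).le) (x := s) (y := t) hs (hs.trans hst)
    simpa [abs_of_nonneg (sub_nonneg.2 hst)] using h
  subst hL
  obtain ⟨F, hF, hFu⟩ := exists_riemann_invariant hUopen (fun t ht => (hℓpos t ht).le) hℓlip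
    hUK huC2 hwave hbc0
  have hφ'c : ContinuousOn φ' (Ici (-ℓ 0)) :=
    (hφC1.continuousOn_derivWithin (uniqueDiffOn_Ici _) le_rfl).congr fun s hs =>
      ((hφd s hs).derivWithin (uniqueDiffOn_Ici _ s hs)).symm
  have hβa : ∀ t ∈ Ici (0 : ℝ), -ℓ 0 ≤ t - ℓ t := fun t ht => by
    linarith [(abs_le.1 (hℓlip 0 t le_rfl ht)).2]
  have hαa : ∀ t ∈ Ici (0 : ℝ), -ℓ 0 ≤ t + ℓ t := fun t ht => by
    linarith [hβa t ht, hℓpos t ht]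
  have hα : ∀ t ∈ Ici (0 : ℝ), HasDerivWithinAt (fun t => t + ℓ t) (1 + ℓ' t) (Ici 0) t :=
    fun t ht => (hasDerivWithinAt_id t _).add (hℓd t ht)
  have hβ : ∀ t ∈ Ici (0 : ℝ), HasDerivWithinAt (fun t => t - ℓ t) (1 - ℓ' t) (Ici 0) t :=
    fun t ht => (hasDerivWithinAt_id t _).sub (hℓd t ht)
  have hsub : ∀ t ∈ Ici (0 : ℝ), Icc (t - ℓ t) (t + ℓ t) ⊆ Ici (-ℓ 0) := fun t ht s hs =>
    (hβa t ht).trans hs.1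
  have hMoore' : ∀ t ∈ Ici (0 : ℝ),
      φ' (t + ℓ t) * (1 + ℓ' t) = φ' (t - ℓ t) * (1 - ℓ' t) := by
    intro t ht
    have h1 := ((hφd _ (hαa t ht)).comp t (hα t ht) hαa).sub
      ((hφd _ (hβa t ht)).comp t (hβ t ht) hβa)
    have h2 : HasDerivWithinAt (fun _ : ℝ => (2 : ℝ)) 0 (Ici 0) t := hasDerivWithinAt_const _ _ _
    have h3 := (uniqueDiffOn_Ici (0 : ℝ) t ht).eq_deriv _ h1
      (h2.congr (fun s hs => hMoore s hs) (hMoore t ht))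
    linarith
  set I : ℝ := ∫ s in (0 - ℓ 0)..(0 + ℓ 0), F s ^ 2 / φ' s with hI
  have hinv : ∀ t, 0 ≤ t → ∫ s in (t - ℓ t)..(t + ℓ t), F s ^ 2 / φ' s = I := by
    intro t ht
    refine intervalIntegral_eq_of_flux_eq (G := fun s => F s ^ 2 / φ' s)
      ((hF.pow 2).div hφ'c fun s hs => (hφpos s hs).ne') hα hβ hαa hβa (fun t ht => ?_) ht
    have hmem : ℓ t ∈ Icc 0 (ℓ t) := right_mem_Icc.2 (hℓpos t ht.le).le
    obtain ⟨h1, h2⟩ := hFu _ t ht.le hmem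
    have hFF : F (t + ℓ t) * (1 + ℓ' t) = -(F (t - ℓ t) * (1 - ℓ' t)) := by
      rw [← h1, ← h2]
      linear_combination 2 * hbcℓ t ht
    have hp := hφpos _ (hαa t ht.le)
    have hq := hφpos _ (hβa t ht.le)
    have hs := abs_lt.1 (hℓspeed t ht.le)
    have hM := hMoore' t ht.le
    have hplus : (0 : ℝ) < 1 + ℓ' t := by linarith [hs.1]
    have hminus : (0 : ℝ) < 1 - ℓ' t := by linarith [hs.2]
    calc F (t + ℓ t) ^ 2 / φ' (t + ℓ t) * (1 + ℓ' t)
        = (F (t + ℓ t) * (1 + ℓ' t)) ^ 2 / (φ' (t + ℓ t) * (1 + ℓ' t)) := by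
          field_simp
      _ = (F (t - ℓ t) * (1 - ℓ' t)) ^ 2 / (φ' (t - ℓ t) * (1 - ℓ' t)) := by
          rw [hFF, hM, neg_sq]
      _ = F (t - ℓ t) ^ 2 / φ' (t - ℓ t) * (1 - ℓ' t) := by
          field_simp
  have hbounds : ∀ t, 0 ≤ t → 0 < m t ∧ 0 < M t ∧
      m t * I ≤ 4 * E t ∧ 4 * E t ≤ M t * I := by
    intro t ht
    have hl := hℓpos t ht
    have hFt := hF.mono (hsub t ht)
    have hφt := hφ'c.mono (hsub t ht)
    have hpos : ∀ s ∈ Icc (t - ℓ t) (t + ℓ t), 0 < φ' s := fun s hs => hφpos s (hsub t ht hs)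
    obtain ⟨hm0, hmM⟩ := reflected_extrema_bounds hl.le hφt hpos
    rw [← hm t, ← hM t] at *
    have hEt : 4 * E t = ∫ s in (t - ℓ t)..(t + ℓ t), F s ^ 2 := by
      rw [← integral_add_comp_add_sub (H := fun s => F s ^ 2) hl.le (hFt.pow 2), hE, ← mul_assoc,
        ← intervalIntegral.integral_const_mul]
      refine intervalIntegral.integral_congr fun x hx => ?_
      rw [uIcc_of_le hl.le] at hx
      obtain ⟨h1, h2⟩ := hFu x t ht hx
      simp only [← h1, ← h2]
      ring
    have hcomp := integral_sq_div_weight_bounds (by linarith) hFt hφt hpos hmM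
    rw [hinv t ht, ← hEt] at hcomp
    have hmid := hmM t ⟨by linarith, by linarith⟩
    exact ⟨hm0, by linarith, hcomp⟩
  intro t₀ t ht₀ htt
  obtain ⟨hm₀, hM₀, hlo₀, hhi₀⟩ := hbounds t₀ ht₀
  obtain ⟨hmt, hMt, hlo, hhi⟩ := hbounds t (ht₀.trans htt.le)
  constructor
  · have h : 4 * E t₀ / M t₀ ≤ I := (div_le_iff₀' hM₀).2 hhi₀
    have := mul_le_mul_of_nonneg_left h hmt.le
    have e : m t / M t₀ * E t₀ = m t * (4 * E t₀ / M t₀) / 4 := by ring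
    linarith
  · have h : I ≤ 4 * E t₀ / m t₀ := (le_div_iff₀' hm₀).2 hlo₀
    have := mul_le_mul_of_nonneg_left h hMt.le
    have e : M t / m t₀ * E t₀ = M t * (4 * E t₀ / m t₀) / 4 := by ring
    linarith
end

section
/- In the undamped case (boundary condition u_x(ℓ(t),t) + ℓ′(t) u_t(ℓ(t),t) = 0), suppose φ′ is monotone on [t₀ − ℓ(t₀), t₁ + ℓ(t₁)] and −1 < ℓ′(t) ≤ 0 for all t ∈ [t₀,t₁]. Then φ′ is nondecreasing there, the energy E(t) is nondecreasing on [t₀,t₁], and for all t ∈ [t₀,t₁]: (φ′(t − ℓ(t))/φ′(t₀ + ℓ(t₀))) E(t₀) ≤ E(t) ≤ (φ′(t + ℓ(t))/φ′(t₀ − ℓ(t₀))) E(t₀). -/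
open Set Filter Topology

/-- A function that is `C¹` on a half-line has a continuous derivative there. -/
lemma continuousOn_of_contDiffOn_one_Ici {f f' : ℝ → ℝ} {a : ℝ} (hf : ContDiffOn ℝ 1 f (Ici a))
    (hd : ∀ t ∈ Ici a, HasDerivWithinAt f (f' t) (Ici a) t) : ContinuousOn f' (Ici a) :=
  (hf.continuousOn_derivWithin (uniqueDiffOn_Ici a) le_rfl).congr fun t ht =>
    ((hd t ht).derivWithin (uniqueDiffOn_Ici a t ht)).symm

/-- Precomposing with `max · a` extends a function continuous on `[a, ∞)` continuously to `ℝ`. -/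
lemma ContinuousOn.continuous_comp_max {f : ℝ → ℝ} {a : ℝ} (hf : ContinuousOn f (Ici a)) :
    Continuous fun s => f (max s a) :=
  hf.comp_continuous (by fun_prop) fun s => le_max_right s a

lemma monotoneOn_Ici_of_hasDerivWithinAt_nonneg {f f' : ℝ → ℝ} {a : ℝ}
    (hd : ∀ t ∈ Ici a, HasDerivWithinAt f (f' t) (Ici a) t) (h0 : ∀ t ∈ Ici a, 0 ≤ f' t) :
    MonotoneOn f (Ici a) := by
  refine monotoneOn_of_hasDerivWithinAt_nonneg (convex_Ici a)
    (fun t ht => (hd t ht).continuousWithinAt) (f' := f') ?_ ?_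
  · intro t ht
    exact (hd t (interior_subset ht)).mono interior_subset
  · exact fun t ht => h0 t (interior_subset ht)

section MovingBoundary

variable {ℓ ℓ' : ℝ → ℝ}

lemma monotoneOn_add_boundary (hd : ∀ t ∈ Ici (0:ℝ), HasDerivWithinAt ℓ (ℓ' t) (Ici 0) t)
    (hs : ∀ t ∈ Ici (0:ℝ), |ℓ' t| < 1) : MonotoneOn (fun t => t + ℓ t) (Ici 0) :=
  monotoneOn_Ici_of_hasDerivWithinAt_nonneg (f' := fun t => 1 + ℓ' t)
    (fun t ht => (hasDerivWithinAt_id t _).add (hd t ht))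
    fun t ht => by linarith [(abs_lt.1 (hs t ht)).1]

lemma monotoneOn_sub_boundary (hd : ∀ t ∈ Ici (0:ℝ), HasDerivWithinAt ℓ (ℓ' t) (Ici 0) t)
    (hs : ∀ t ∈ Ici (0:ℝ), |ℓ' t| < 1) : MonotoneOn (fun t => t - ℓ t) (Ici 0) :=
  monotoneOn_Ici_of_hasDerivWithinAt_nonneg (f' := fun t => 1 - ℓ' t)
    (fun t ht => (hasDerivWithinAt_id t _).sub (hd t ht))
    fun t ht => by linarith [(abs_lt.1 (hs t ht)).2]

/-- The differentiated Moore equation. -/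
lemma moore_deriv {φ φ' : ℝ → ℝ} {L : ℝ} (hL : ℓ 0 = L)
    (hd : ∀ t ∈ Ici (0:ℝ), HasDerivWithinAt ℓ (ℓ' t) (Ici 0) t)
    (hpos : ∀ t ∈ Ici (0:ℝ), 0 < ℓ t) (hs : ∀ t ∈ Ici (0:ℝ), |ℓ' t| < 1)
    (hφ : ∀ s ∈ Ici (-L), HasDerivWithinAt φ (φ' s) (Ici (-L)) s)
    (hM : ∀ t ∈ Ici (0:ℝ), φ (t + ℓ t) - φ (t - ℓ t) = 2) {t : ℝ} (ht : t ∈ Ici (0:ℝ)) :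
    φ' (t + ℓ t) * (1 + ℓ' t) = φ' (t - ℓ t) * (1 - ℓ' t) := by
  have hsub : MapsTo (fun t => t - ℓ t) (Ici 0) (Ici (-L)) := fun r hr => by
    have := monotoneOn_sub_boundary hd hs self_mem_Ici hr hr
    simp only [mem_Ici] at *
    linarith
  have hadd : MapsTo (fun t => t + ℓ t) (Ici 0) (Ici (-L)) := fun r hr => by
    have h1 := hsub hr
    have h2 := hpos r hr
    simp only [mem_Ici] at *
    linarith
  have h1 := (hφ _ (hadd ht)).comp t ((hasDerivWithinAt_id t _).add (hd t ht)) hadd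
  have h2 := (hφ _ (hsub ht)).comp t ((hasDerivWithinAt_id t _).sub (hd t ht)) hsub
  have h3 : HasDerivWithinAt (fun _ : ℝ => (2 : ℝ)) _ (Ici 0) t :=
    (h1.sub h2).congr (fun r hr => (hM r hr).symm) (hM t ht).symm
  have := (uniqueDiffOn_Ici (0:ℝ) t ht).eq_deriv _ h3 (hasDerivWithinAt_const t _ (2:ℝ))
  linarith

/-- Monotonicity of the integral of a continuous function over the moving window
`[t - ℓ t, t + ℓ t]`. -/
lemma monotoneOn_window_integral {w : ℝ → ℝ} (hw : Continuous w)
    (hd : ∀ t ∈ Ici (0:ℝ), HasDerivWithinAt ℓ (ℓ' t) (Ici 0) t) {t₀ t₁ : ℝ} (ht₀ : 0 ≤ t₀)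
    (h : ∀ t ∈ Ioo t₀ t₁, 0 ≤ w (t + ℓ t) * (1 + ℓ' t) - w (t - ℓ t) * (1 - ℓ' t)) :
    MonotoneOn (fun t => ∫ s in (t - ℓ t)..(t + ℓ t), w s) (Icc t₀ t₁) := by
  have hprim : ∀ b, HasDerivAt (fun b => ∫ s in (0:ℝ)..b, w s) (w b) b := fun b =>
    intervalIntegral.integral_hasDerivAt_right (hw.intervalIntegrable _ _)
      hw.aestronglyMeasurable.stronglyMeasurableAtFilter hw.continuousAt
  have heq : (fun t => ∫ s in (t - ℓ t)..(t + ℓ t), w s) =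
      fun t => (∫ s in (0:ℝ)..(t + ℓ t), w s) - ∫ s in (0:ℝ)..(t - ℓ t), w s := by
    funext t
    exact (intervalIntegral.integral_interval_sub_left (hw.intervalIntegrable _ _)
      (hw.intervalIntegrable _ _)).symm
  have hder : ∀ t ∈ Ici (0:ℝ), HasDerivWithinAt (fun t => ∫ s in (t - ℓ t)..(t + ℓ t), w s)
      (w (t + ℓ t) * (1 + ℓ' t) - w (t - ℓ t) * (1 - ℓ' t)) (Ici 0) t := by
    intro t ht
    rw [heq]
    exact ((hprim _).comp_hasDerivWithinAt t ((hasDerivWithinAt_id t _).add (hd t ht))).sub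
      ((hprim _).comp_hasDerivWithinAt t ((hasDerivWithinAt_id t _).sub (hd t ht)))
  have hsub : Icc t₀ t₁ ⊆ Ici 0 := fun t ht => ht₀.trans ht.1
  refine monotoneOn_of_hasDerivWithinAt_nonneg (convex_Icc _ _)
    (fun t ht => ((hder t (hsub ht)).continuousWithinAt).mono hsub)
    (fun t ht => (hder t (hsub (interior_subset ht))).mono (interior_subset.trans hsub)) ?_
  rw [interior_Icc]
  exact h

/-- If the boundary is not expanding, a monotone solution `φ'` of the differentiated Moore equation
is nondecreasing. -/
lemma monotoneOn_moore_deriv {φ' : ℝ → ℝ} {t₀ t₁ : ℝ} (ht₀₁ : t₀ ≤ t₁)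
    (hpos : ∀ t ∈ Icc t₀ t₁, 0 < ℓ t)
    (hadd : MonotoneOn (fun t => t + ℓ t) (Icc t₀ t₁))
    (hsub : MonotoneOn (fun t => t - ℓ t) (Icc t₀ t₁))
    (hφpos : ∀ s ∈ Icc (t₀ - ℓ t₀) (t₁ + ℓ t₁), 0 < φ' s)
    (hM : ∀ t ∈ Icc t₀ t₁, φ' (t + ℓ t) * (1 + ℓ' t) = φ' (t - ℓ t) * (1 - ℓ' t))
    (hshr : ∀ t ∈ Icc t₀ t₁, -1 < ℓ' t ∧ ℓ' t ≤ 0)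
    (hmono : MonotoneOn φ' (Icc (t₀ - ℓ t₀) (t₁ + ℓ t₁)) ∨
      AntitoneOn φ' (Icc (t₀ - ℓ t₀) (t₁ + ℓ t₁))) :
    MonotoneOn φ' (Icc (t₀ - ℓ t₀) (t₁ + ℓ t₁)) := by
  refine hmono.elim id fun hanti => ?_
  have hl : t₀ ∈ Icc t₀ t₁ := ⟨le_rfl, ht₀₁⟩
  have hr : t₁ ∈ Icc t₀ t₁ := ⟨ht₀₁, le_rfl⟩
  have hloc : ∀ t ∈ Icc t₀ t₁, ∀ s ∈ Icc (t - ℓ t) (t + ℓ t), φ' s = φ' t := by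
    intro t ht s hs
    have hp := hpos t ht
    have e1 := hsub hl ht ht.1
    have e2 := hadd ht hr ht.2
    simp only at e1 e2
    have m1 : t - ℓ t ∈ Icc (t₀ - ℓ t₀) (t₁ + ℓ t₁) := ⟨e1, by linarith⟩
    have m2 : t + ℓ t ∈ Icc (t₀ - ℓ t₀) (t₁ + ℓ t₁) := ⟨by linarith, e2⟩
    have key : ∀ r ∈ Icc (t - ℓ t) (t + ℓ t), φ' r = φ' (t - ℓ t) := by
      intro r hr
      have m3 : r ∈ Icc (t₀ - ℓ t₀) (t₁ + ℓ t₁) := ⟨m1.1.trans hr.1, hr.2.trans m2.2⟩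
      refine le_antisymm (hanti m1 m3 hr.1) (le_trans ?_ (hanti m3 m2 hr.2))
      have := hM t ht
      have h1 := hφpos _ m1
      have h2 := hφpos _ m2
      obtain ⟨g1, g2⟩ := hshr t ht
      by_contra! hlt
      nlinarith
    rw [key s hs, key t ⟨by linarith, by linarith⟩]
  have hmid : ∀ t ∈ Icc t₀ t₁, φ' t = φ' t₀ := by
    have hder : ∀ t ∈ Icc t₀ t₁, HasDerivAt φ' 0 t := fun t ht => by
      have hp := hpos t ht
      refine (hasDerivAt_const t (φ' t)).congr_of_eventuallyEq ?_
      filter_upwards [Icc_mem_nhds (sub_lt_self t hp) (lt_add_of_pos_right t hp)] with s hs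
      exact hloc t ht s hs
    exact constant_of_has_deriv_right_zero
      (fun t ht => (hder t ht).continuousAt.continuousWithinAt)
      fun t ht => (hder t (Ico_subset_Icc_self ht)).hasDerivWithinAt
  have hconst : ∀ s ∈ Icc (t₀ - ℓ t₀) (t₁ + ℓ t₁), φ' s = φ' t₀ := by
    intro s hs
    have p0 := hpos t₀ hl
    have p1 := hpos t₁ hr
    rcases le_total s t₀ with h | h
    · exact hloc t₀ hl s ⟨hs.1, by linarith⟩
    rcases le_total s t₁ with h' | h'
    · exact hmid s ⟨h, h'⟩
    · rw [hloc t₁ hr s ⟨by linarith, hs.2⟩, hmid t₁ hr]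
  intro a ha b hb _
  rw [hconst a ha, hconst b hb]

end MovingBoundary

section Wave

variable {u : ℝ → ℝ → ℝ}

lemma hasDerivAt_fderiv_apply_comp {f : ℝ × ℝ → ℝ} {γ : ℝ → ℝ × ℝ} {v : ℝ × ℝ} {s : ℝ}
    (hγ : HasDerivAt γ v s) (h : ContDiffAt ℝ 2 f (γ s)) (w : ℝ × ℝ) :
    HasDerivAt (fun r => fderiv ℝ f (γ r) w) (fderiv ℝ (fderiv ℝ f) (γ s) v w) s := by
  have hd : DifferentiableAt ℝ (fderiv ℝ f) (γ s) :=
    (h.fderiv_right (m := 1) (by norm_num)).differentiableAt (by norm_num)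
  have hc : HasDerivAt (fun r => fderiv ℝ f (γ r)) (fderiv ℝ (fderiv ℝ f) (γ s) v) s :=
    hd.hasFDerivAt.comp_hasDerivAt s hγ
  simpa using hc.clm_apply (hasDerivAt_const s w)

lemma hasDerivAt_mk_left (x t : ℝ) : HasDerivAt (fun y : ℝ => (y, t)) ((1 : ℝ), (0 : ℝ)) x :=
  (hasDerivAt_id x).prodMk (hasDerivAt_const x t)

lemma hasDerivAt_mk_right (x t : ℝ) : HasDerivAt (fun s : ℝ => (x, s)) ((0 : ℝ), (1 : ℝ)) t :=
  (hasDerivAt_const t x).prodMk (hasDerivAt_id t)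

lemma deriv_fst_eq_fderiv {x t : ℝ} (h : DifferentiableAt ℝ (fun p : ℝ × ℝ => u p.1 p.2) (x, t)) :
    deriv (fun y => u y t) x = fderiv ℝ (fun p : ℝ × ℝ => u p.1 p.2) (x, t) (1, 0) := by
  have := h.hasFDerivAt.comp_hasDerivAt x (hasDerivAt_mk_left x t)
  exact this.deriv

lemma deriv_snd_eq_fderiv {x t : ℝ} (h : DifferentiableAt ℝ (fun p : ℝ × ℝ => u p.1 p.2) (x, t)) :
    deriv (u x) t = fderiv ℝ (fun p : ℝ × ℝ => u p.1 p.2) (x, t) (0, 1) := by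
  have := h.hasFDerivAt.comp_hasDerivAt t (hasDerivAt_mk_right x t)
  exact this.deriv

lemma deriv_deriv_fst_eq_fderiv {x t : ℝ}
    (h : ContDiffAt ℝ 2 (fun p : ℝ × ℝ => u p.1 p.2) (x, t)) :
    deriv (deriv fun y => u y t) x =
      fderiv ℝ (fderiv ℝ fun p : ℝ × ℝ => u p.1 p.2) (x, t) (1, 0) (1, 0) := by
  have hev : deriv (fun y => u y t) =ᶠ[𝓝 x]
      fun y => fderiv ℝ (fun p : ℝ × ℝ => u p.1 p.2) (y, t) (1, 0) := by
    filter_upwards [(hasDerivAt_mk_left x t).continuousAt.eventually (h.eventually (by simp))]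
      with y hy
    exact deriv_fst_eq_fderiv (hy.differentiableAt (by norm_num))
  rw [hev.deriv_eq]
  exact (hasDerivAt_fderiv_apply_comp (hasDerivAt_mk_left x t) h (1, 0)).deriv

lemma deriv_deriv_snd_eq_fderiv {x t : ℝ}
    (h : ContDiffAt ℝ 2 (fun p : ℝ × ℝ => u p.1 p.2) (x, t)) :
    deriv (deriv (u x)) t =
      fderiv ℝ (fderiv ℝ fun p : ℝ × ℝ => u p.1 p.2) (x, t) (0, 1) (0, 1) := by
  have hev : deriv (u x) =ᶠ[𝓝 t]
      fun s => fderiv ℝ (fun p : ℝ × ℝ => u p.1 p.2) (x, s) (0, 1) := by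
    filter_upwards [(hasDerivAt_mk_right x t).continuousAt.eventually (h.eventually (by simp))]
      with s hs
    exact deriv_snd_eq_fderiv (hs.differentiableAt (by norm_num))
  rw [hev.deriv_eq]
  exact (hasDerivAt_fderiv_apply_comp (hasDerivAt_mk_right x t) h (0, 1)).deriv

/-- Along the characteristics `σ ↦ (x - σ, t + e σ)`, `e = ±1`, of the wave equation the Riemann
invariant `u_x + e u_t` is constant. -/
lemma riemann_invariant_const {e x t c : ℝ} (he : e ^ 2 = 1) (hc : 0 ≤ c)
    (hC2 : ∀ σ ∈ Icc 0 c, ContDiffAt ℝ 2 (fun p : ℝ × ℝ => u p.1 p.2) (x - σ, t + e * σ))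
    (hwave : ∀ σ ∈ Icc 0 c, deriv (deriv (u (x - σ))) (t + e * σ) =
      deriv (deriv fun y => u y (t + e * σ)) (x - σ)) :
    fderiv ℝ (fun p : ℝ × ℝ => u p.1 p.2) (x - c, t + e * c) (1, e) =
      fderiv ℝ (fun p : ℝ × ℝ => u p.1 p.2) (x, t) (1, e) := by
  set f : ℝ × ℝ → ℝ := fun p => u p.1 p.2
  have hder : ∀ σ ∈ Icc 0 c,
      HasDerivAt (fun σ => fderiv ℝ f (x - σ, t + e * σ) (1, e)) 0 σ := by
    intro σ hσ
    have h := hC2 σ hσ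
    have hline : HasDerivAt (fun σ : ℝ => (x - σ, t + e * σ)) ((-1 : ℝ), e) σ := by
      simpa using ((hasDerivAt_id σ).const_sub x).prodMk
        (((hasDerivAt_id σ).const_mul e).const_add t)
    convert hasDerivAt_fderiv_apply_comp hline h (1, e) using 1
    have hsymm := (h.isSymmSndFDerivAt (by simp)).eq (1, 0) (0, 1)
    have hw := hwave σ hσ
    rw [deriv_deriv_fst_eq_fderiv h, deriv_deriv_snd_eq_fderiv h] at hw
    have e1 : ((-1 : ℝ), e) = (-1 : ℝ) • ((1 : ℝ), (0 : ℝ)) + e • ((0 : ℝ), (1 : ℝ)) := by simp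
    have e2 : ((1 : ℝ), e) = ((1 : ℝ), (0 : ℝ)) + e • ((0 : ℝ), (1 : ℝ)) := by simp
    rw [e1, e2]
    simp only [map_add, map_smul, add_apply, smul_apply, smul_eq_mul]
    change fderiv ℝ (fderiv ℝ f) _ _ _ = fderiv ℝ (fderiv ℝ f) _ _ _ at hw
    rw [hsymm, hw]
    linear_combination (-(fderiv ℝ (fderiv ℝ f) (x - σ, t + e * σ) (1, 0)) (1, 0)) * he
  have := constant_of_has_deriv_right_zero
    (fun σ hσ => (hder σ hσ).continuousAt.continuousWithinAt)
    (fun σ hσ => (hder σ (Ico_subset_Icc_self hσ)).hasDerivWithinAt) c ⟨hc, le_rfl⟩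
  simpa using this

end Wave

/-- A solution of the wave equation in the noncylindrical domain, vanishing at `x = 0`, has
derivatives `u_x = h (t + x) + h (t - x)` and `u_t = h (t + x) - h (t - x)`. -/
lemma exists_dAlembert_profile {L : ℝ} {ℓ ℓ' : ℝ → ℝ}
    (hℓd : ∀ t ∈ Ici (0:ℝ), HasDerivWithinAt ℓ (ℓ' t) (Ici 0) t)
    (hℓpos : ∀ t ∈ Ici (0:ℝ), 0 < ℓ t) (hℓspeed : ∀ t ∈ Ici (0:ℝ), |ℓ' t| < 1) (hL : ℓ 0 = L)
    {u : ℝ → ℝ → ℝ} {U : Set (ℝ × ℝ)} (hUopen : IsOpen U)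
    (hUK : {p : ℝ × ℝ | 0 ≤ p.2 ∧ p.1 ∈ Icc 0 (ℓ p.2)} ⊆ U)
    (huC2 : ContDiffOn ℝ 2 (fun p : ℝ × ℝ => u p.1 p.2) U)
    (hwave : ∀ x t : ℝ, 0 ≤ t → x ∈ Icc 0 (ℓ t) →
      deriv (deriv (u x)) t = deriv (deriv (fun y => u y t)) x)
    (hbc0 : ∀ t : ℝ, 0 ≤ t → u 0 t = 0) :
    ∃ h : ℝ → ℝ, Continuous h ∧ ∀ t, 0 ≤ t → ∀ x ∈ Icc 0 (ℓ t),
      deriv (fun y => u y t) x = h (t + x) + h (t - x) ∧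
      deriv (u x) t = h (t + x) - h (t - x) := by
  have hadd := monotoneOn_add_boundary hℓd hℓspeed
  have hsub := monotoneOn_sub_boundary hℓd hℓspeed
  have hC2 : ∀ x t : ℝ, 0 ≤ t → x ∈ Icc 0 (ℓ t) →
      ContDiffAt ℝ 2 (fun p : ℝ × ℝ => u p.1 p.2) (x, t) := fun x t ht hx =>
    huC2.contDiffAt (hUopen.mem_nhds (hUK ⟨ht, hx⟩))
  have hLpos : 0 < L := hL ▸ hℓpos 0 self_mem_Ici
  set D := fderiv ℝ (fun p : ℝ × ℝ => u p.1 p.2)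
  have hDcont : ContinuousOn D U := huC2.continuousOn_fderiv_of_isOpen hUopen (by norm_num)
  let g : ℝ → ℝ := fun s => D (max (-s) 0, max s 0) (1, -1) / 2
  have hg : ContinuousOn g (Ici (-L)) := by
    have hmaps : MapsTo (fun s : ℝ => (max (-s) 0, max s 0)) (Ici (-L)) U := by
      intro s hs
      refine hUK ⟨le_max_right _ _, le_max_right _ _, ?_⟩
      rcases le_total s 0 with h | h
      · simp only [mem_Ici] at hs
        simp only [max_eq_right h, hL]
        exact max_le (by linarith) hLpos.le
      · simpa [max_eq_left h, h] using (hℓpos s h).le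
    exact ((hDcont.comp (by fun_prop) hmaps).clm_apply continuousOn_const).div_const 2
  have hD0 : ∀ t, 0 ≤ t → D (0, t) (0, 1) = 0 := by
    intro t ht
    have hd := (hC2 0 t ht ⟨le_rfl, (hℓpos t ht).le⟩).differentiableAt (by norm_num)
    have h1 : HasDerivAt (u 0) (D (0, t) (0, 1)) t :=
      hd.hasFDerivAt.comp_hasDerivAt t (hasDerivAt_mk_right 0 t)
    exact (uniqueDiffOn_Ici (0:ℝ) t ht).eq_deriv _ h1.hasDerivWithinAt
      ((hasDerivWithinAt_const t _ (0:ℝ)).congr hbc0 (hbc0 t ht))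
  have hQ : ∀ t, 0 ≤ t → ∀ x ∈ Icc 0 (ℓ t), D (x, t) (1, -1) = 2 * g (t - x) := by
    intro t ht x hx
    have hmem : ∀ σ ∈ Icc 0 (min x t), 0 ≤ t + -1 * σ ∧ x - σ ∈ Icc 0 (ℓ (t + -1 * σ)) := by
      intro σ hσ
      obtain ⟨h1, h2⟩ := le_min_iff.1 hσ.2
      have h0 : 0 ≤ t + -1 * σ := by linarith
      have := hsub h0 ht (by linarith [hσ.1])
      simp only at this
      exact ⟨h0, by linarith, by linarith [hx.2]⟩
    have key := riemann_invariant_const (u := u) (e := -1) (x := x) (t := t) (c := min x t)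
      (by norm_num) (le_min hx.1 ht) (fun σ hσ => hC2 _ _ (hmem σ hσ).1 (hmem σ hσ).2)
      (fun σ hσ => hwave _ _ (hmem σ hσ).1 (hmem σ hσ).2)
    have e1 : x - min x t = max (-(t - x)) 0 := by
      rcases le_total x t with h | h <;> simp [h]
    have e2 : t + -1 * min x t = max (t - x) 0 := by
      rcases le_total x t with h | h <;> simp [h, ← sub_eq_add_neg]
    rw [e1, e2] at key
    simp only [g]
    linarith [key]
  have hP : ∀ t, 0 ≤ t → ∀ x ∈ Icc 0 (ℓ t), D (x, t) (1, 1) = 2 * g (t + x) := by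
    intro t ht x hx
    have hmem : ∀ σ ∈ Icc 0 x, 0 ≤ t + 1 * σ ∧ x - σ ∈ Icc 0 (ℓ (t + 1 * σ)) := by
      intro σ hσ
      have h0 : 0 ≤ t + 1 * σ := by linarith [hσ.1]
      have := hadd ht h0 (by linarith [hσ.1])
      simp only at this
      exact ⟨h0, by linarith [hσ.2], by linarith [hx.2]⟩
    have key := riemann_invariant_const (u := u) (e := 1) (x := x) (t := t) (c := x)
      (by norm_num) hx.1 (fun σ hσ => hC2 _ _ (hmem σ hσ).1 (hmem σ hσ).2)
      (fun σ hσ => hwave _ _ (hmem σ hσ).1 (hmem σ hσ).2)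
    have h0 : 0 ≤ t + x := add_nonneg ht hx.1
    rw [sub_self, one_mul] at key
    have e := hQ (t + x) h0 0 ⟨le_rfl, (hℓpos _ h0).le⟩
    have z := hD0 (t + x) h0
    have s1 : D (0, t + x) (1, 1) = D (0, t + x) (1, -1) + 2 * D (0, t + x) (0, 1) := by
      rw [← smul_eq_mul, ← map_smul, ← map_add]
      norm_num
    rw [sub_zero] at e
    rw [← key, ← e]
    linarith
  refine ⟨fun s => g (max s (-L)), hg.continuous_comp_max, fun t ht x hx => ?_⟩
  have hd := (hC2 x t ht hx).differentiableAt (by norm_num)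
  have hlow : -L ≤ t - x := by
    have := hsub self_mem_Ici ht ht
    simp only at this
    linarith [hx.2]
  rw [deriv_fst_eq_fderiv hd, deriv_snd_eq_fderiv hd]
  simp only [max_eq_left hlow, max_eq_left (hlow.trans (by linarith [hx.1] : t - x ≤ t + x))]
  have p := hP t ht x hx
  have q := hQ t ht x hx
  have s1 : D (x, t) (1, 1) = D (x, t) (1, 0) + D (x, t) (0, 1) := by
    rw [← map_add]; norm_num
  have s2 : D (x, t) (1, -1) = D (x, t) (1, 0) - D (x, t) (0, 1) := by
    rw [← map_sub]; norm_num
  constructor <;> linarith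

/-- The energy density integrates to the square of the wave profile over the dependence
window. -/
lemma energy_eq_window_integral {h : ℝ → ℝ} (hcont : Continuous h) {u : ℝ → ℝ → ℝ} {t a : ℝ}
    (ha : 0 ≤ a) (hu : ∀ x ∈ Icc 0 a, deriv (fun y => u y t) x = h (t + x) + h (t - x) ∧
      deriv (u x) t = h (t + x) - h (t - x)) :
    (1 / 2) * ∫ x in (0:ℝ)..a, ((deriv (u x) t) ^ 2 + (deriv (fun y => u y t) x) ^ 2) =
      ∫ s in (t - a)..(t + a), h s ^ 2 := by
  have hint : ∀ b c, IntervalIntegrable (fun s => h s ^ 2) MeasureTheory.volume b c :=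
    (hcont.pow 2).intervalIntegrable
  have hcongr : ∫ x in (0:ℝ)..a, ((deriv (u x) t) ^ 2 + (deriv (fun y => u y t) x) ^ 2) =
      ∫ x in (0:ℝ)..a, 2 * (h (t + x) ^ 2 + h (t - x) ^ 2) := by
    refine intervalIntegral.integral_congr fun x hx => ?_
    rw [uIcc_of_le ha] at hx
    simp only [(hu x hx).1, (hu x hx).2]
    ring
  have hadd : ∫ x in (0:ℝ)..a, (h (t + x) ^ 2 + h (t - x) ^ 2) =
      (∫ x in (0:ℝ)..a, h (t + x) ^ 2) + ∫ x in (0:ℝ)..a, h (t - x) ^ 2 :=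
    intervalIntegral.integral_add (Continuous.intervalIntegrable (by fun_prop) _ _)
      (Continuous.intervalIntegrable (by fun_prop) _ _)
  rw [hcongr, intervalIntegral.integral_const_mul, hadd,
    intervalIntegral.integral_comp_add_left (fun s => h s ^ 2),
    intervalIntegral.integral_comp_sub_left (fun s => h s ^ 2), add_zero, sub_zero,
    ← intervalIntegral.integral_add_adjacent_intervals (hint (t - a) t) (hint t (t + a))]
  ring

theorem undamped_shrinking_energy_estimate
    (L : ℝ) (ℓ ℓ' : ℝ → ℝ)
    (hℓC1 : ContDiffOn ℝ 1 ℓ (Set.Ici 0))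
    (hℓd : ∀ t ∈ Set.Ici (0:ℝ), HasDerivWithinAt ℓ (ℓ' t) (Set.Ici 0) t)
    (hℓpos : ∀ t ∈ Set.Ici (0:ℝ), 0 < ℓ t)
    (hℓspeed : ∀ t ∈ Set.Ici (0:ℝ), |ℓ' t| < 1)
    (hL : ℓ 0 = L)
    (u : ℝ → ℝ → ℝ) (U : Set (ℝ × ℝ)) (hUopen : IsOpen U)
    (hUK : {p : ℝ × ℝ | 0 ≤ p.2 ∧ p.1 ∈ Set.Icc 0 (ℓ p.2)} ⊆ U)
    (huC2 : ContDiffOn ℝ 2 (fun p : ℝ × ℝ => u p.1 p.2) U)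
    (hwave : ∀ x t : ℝ, 0 ≤ t → x ∈ Set.Icc 0 (ℓ t) →
      deriv (deriv (u x)) t = deriv (deriv (fun y => u y t)) x)
    (hbc0 : ∀ t : ℝ, 0 ≤ t → u 0 t = 0)
    (hbcℓ : ∀ t : ℝ, 0 < t →
      deriv (fun y => u y t) (ℓ t) + ℓ' t * deriv (u (ℓ t)) t = 0)
    (φ φ' : ℝ → ℝ)
    (hφC1 : ContDiffOn ℝ 1 φ (Set.Ici (-L)))
    (hφd : ∀ s ∈ Set.Ici (-L), HasDerivWithinAt φ (φ' s) (Set.Ici (-L)) s)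
    (hφpos : ∀ s ∈ Set.Ici (-L), 0 < φ' s)
    (hMoore : ∀ t ∈ Set.Ici (0:ℝ), φ (t + ℓ t) - φ (t - ℓ t) = 2)
    (E : ℝ → ℝ)
    (hE : ∀ t : ℝ, E t = (1/2) * ∫ x in (0:ℝ)..(ℓ t),
      ((deriv (u x) t)^2 + (deriv (fun y => u y t) x)^2))
    (t₀ t₁ : ℝ) (ht₀ : 0 ≤ t₀) (ht₀₁ : t₀ ≤ t₁)
    (hmono : MonotoneOn φ' (Set.Icc (t₀ - ℓ t₀) (t₁ + ℓ t₁)) ∨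
      AntitoneOn φ' (Set.Icc (t₀ - ℓ t₀) (t₁ + ℓ t₁)))
    (hshr : ∀ t ∈ Set.Icc t₀ t₁, -1 < ℓ' t ∧ ℓ' t ≤ 0)
    : MonotoneOn φ' (Set.Icc (t₀ - ℓ t₀) (t₁ + ℓ t₁)) ∧
      MonotoneOn E (Set.Icc t₀ t₁) ∧
      ∀ t ∈ Set.Icc t₀ t₁,
        φ' (t - ℓ t) / φ' (t₀ + ℓ t₀) * E t₀ ≤ E t ∧
        E t ≤ φ' (t + ℓ t) / φ' (t₀ - ℓ t₀) * E t₀ := by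
  have hadd := monotoneOn_add_boundary hℓd hℓspeed
  have hsub := monotoneOn_sub_boundary hℓd hℓspeed
  have hIcc : Icc t₀ t₁ ⊆ Ici 0 := fun t ht => ht₀.trans ht.1
  have hl : t₀ ∈ Icc t₀ t₁ := ⟨le_rfl, ht₀₁⟩
  have hr : t₁ ∈ Icc t₀ t₁ := ⟨ht₀₁, le_rfl⟩
  have hlow : ∀ t ∈ Ici (0:ℝ), -L ≤ t - ℓ t := fun t ht => by
    have := hsub self_mem_Ici ht ht
    simp only at this
    linarith
  have hM : ∀ t ∈ Ici (0:ℝ), φ' (t + ℓ t) * (1 + ℓ' t) = φ' (t - ℓ t) * (1 - ℓ' t) := fun t ht =>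
    moore_deriv hL hℓd hℓpos hℓspeed hφd hMoore ht
  have hφmono : MonotoneOn φ' (Icc (t₀ - ℓ t₀) (t₁ + ℓ t₁)) :=
    monotoneOn_moore_deriv ht₀₁ (fun t ht => hℓpos t (hIcc ht)) (hadd.mono hIcc) (hsub.mono hIcc)
      (fun s hs => hφpos s ((hlow t₀ ht₀).trans hs.1)) (fun t ht => hM t (hIcc ht)) hshr hmono
  obtain ⟨h, hcont, hu⟩ := exists_dAlembert_profile hℓd hℓpos hℓspeed hL hUopen hUK huC2 hwave hbc0
  have hEh : ∀ t ∈ Ici (0:ℝ), E t = ∫ s in (t - ℓ t)..(t + ℓ t), h s ^ 2 := fun t ht => by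
    rw [hE, energy_eq_window_integral hcont (hℓpos t ht).le (hu t ht)]
  have hrefl : ∀ t, 0 < t → h (t + ℓ t) * (1 + ℓ' t) = -(h (t - ℓ t) * (1 - ℓ' t)) := by
    intro t ht
    obtain ⟨hx, htt⟩ := hu t ht.le (ℓ t) ⟨(hℓpos t ht.le).le, le_rfl⟩
    have := hbcℓ t ht
    rw [hx, htt] at this
    linarith
  refine ⟨hφmono, ?_, fun t ht => ?_⟩
  · refine (monotoneOn_window_integral (w := fun s => h s ^ 2) (hcont.pow 2) hℓd ht₀ fun t ht => ?_).congr
      fun t ht => (hEh t (hIcc ht)).symm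
    obtain ⟨g1, g2⟩ := hshr t (Ioo_subset_Icc_self ht)
    have hreft := hrefl t (ht₀.trans_lt ht.1)
    have g3 : 0 < 1 + ℓ' t := by linarith
    have hsq : (h (t + ℓ t) * (1 + ℓ' t)) ^ 2 = (h (t - ℓ t) * (1 - ℓ' t)) ^ 2 := by
      rw [hreft, neg_sq]
    refine le_of_mul_le_mul_left (a := 1 + ℓ' t) ?_ g3
    have : (1 + ℓ' t) * (h (t + ℓ t) ^ 2 * (1 + ℓ' t) - h (t - ℓ t) ^ 2 * (1 - ℓ' t)) =
        h (t - ℓ t) ^ 2 * (1 - ℓ' t) * (-2 * ℓ' t) := by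
      linear_combination hsq
    rw [this, mul_zero]
    have : 0 ≤ 1 - ℓ' t := by linarith
    have : 0 ≤ -2 * ℓ' t := by linarith
    positivity
  · let ψ : ℝ → ℝ := fun s => φ' (max s (-L))
    have hψ : Continuous ψ := (continuousOn_of_contDiffOn_one_Ici hφC1 hφd).continuous_comp_max
    have hψpos : ∀ s, 0 < ψ s := fun s => hφpos _ (le_max_right s (-L))
    have hψeq : ∀ s, -L ≤ s → ψ s = φ' s := fun s hs => congrArg φ' (max_eq_left hs)
    have hwcont : Continuous fun s => h s ^ 2 / ψ s := (hcont.pow 2).div hψ fun s => (hψpos s).ne'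
    set I : ℝ → ℝ := fun t => ∫ s in (t - ℓ t)..(t + ℓ t), h s ^ 2 / ψ s with hI
    have hflux : ∀ t ∈ Ioo t₀ t₁, h (t + ℓ t) ^ 2 / ψ (t + ℓ t) * (1 + ℓ' t) =
        h (t - ℓ t) ^ 2 / ψ (t - ℓ t) * (1 - ℓ' t) := by
      intro t ht
      have ht0 : 0 < t := ht₀.trans_lt ht.1
      have hb := hlow t ht0.le
      have hp := hℓpos t ht0.le
      have hMt := hM t ht0.le
      rw [← hψeq _ hb, ← hψeq _ (by linarith)] at hMt
      have p1 := hψpos (t + ℓ t)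
      have p2 := hψpos (t - ℓ t)
      have g3 : 0 < 1 + ℓ' t := by linarith [(hshr t (Ioo_subset_Icc_self ht)).1]
      have hsq : (h (t + ℓ t) * (1 + ℓ' t)) ^ 2 = (h (t - ℓ t) * (1 - ℓ' t)) ^ 2 := by
        rw [hrefl t ht0, neg_sq]
      have e1 : h (t + ℓ t) ^ 2 / ψ (t + ℓ t) * (1 + ℓ' t) =
          (h (t + ℓ t) * (1 + ℓ' t)) ^ 2 / (ψ (t + ℓ t) * (1 + ℓ' t)) := by
        field_simp
      have g4 : 0 < 1 - ℓ' t := by linarith [(hshr t (Ioo_subset_Icc_self ht)).2]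
      have e2 : h (t - ℓ t) ^ 2 / ψ (t - ℓ t) * (1 - ℓ' t) =
          (h (t - ℓ t) * (1 - ℓ' t)) ^ 2 / (ψ (t - ℓ t) * (1 - ℓ' t)) := by
        field_simp
      rw [e1, e2, hsq, hMt]
    have hIconst : I t = I t₀ := by
      have m1 := monotoneOn_window_integral hwcont hℓd ht₀
        (fun t ht => (sub_eq_zero.2 (hflux t ht)).ge) hl ht ht.1
      have m2 := monotoneOn_window_integral (w := fun s => -(h s ^ 2 / ψ s)) hwcont.neg hℓd ht₀
        (fun t ht => by linarith [hflux t ht]) hl ht ht.1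
      simp only [intervalIntegral.integral_neg, neg_le_neg_iff] at m1 m2
      exact le_antisymm m2 m1
    have hbounds : ∀ r ∈ Icc t₀ t₁, φ' (r - ℓ r) * I r ≤ E r ∧ E r ≤ φ' (r + ℓ r) * I r := by
      intro r hr'
      have hr0 := hIcc hr'
      have hp := hℓpos r hr0
      have hb := hlow r hr0
      have a1 := hsub (hIcc hl) hr0 hr'.1
      have a2 := hadd hr0 (hIcc hr) hr'.2
      simp only at a1 a2
      rw [hEh r hr0, hI]
      simp only [← intervalIntegral.integral_const_mul]
      have hle : r - ℓ r ≤ r + ℓ r := by linarith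
      have hquot : ∀ s ∈ Icc (r - ℓ r) (r + ℓ r),
          φ' (r - ℓ r) ≤ ψ s ∧ ψ s ≤ φ' (r + ℓ r) := fun s hs => by
        rw [hψeq s (hb.trans hs.1)]
        have ms : s ∈ Icc (t₀ - ℓ t₀) (t₁ + ℓ t₁) := ⟨a1.trans hs.1, hs.2.trans a2⟩
        exact ⟨hφmono ⟨a1, hle.trans a2⟩ ms hs.1, hφmono ms ⟨a1.trans hle, a2⟩ hs.2⟩
      constructor
      · refine intervalIntegral.integral_mono_on hle ((hwcont.const_mul _).intervalIntegrable _ _)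
          ((hcont.pow 2).intervalIntegrable _ _) fun s hs => ?_
        rw [← mul_div_assoc, div_le_iff₀ (hψpos s), mul_comm]
        exact mul_le_mul_of_nonneg_left (hquot s hs).1 (sq_nonneg _)
      · refine intervalIntegral.integral_mono_on hle ((hcont.pow 2).intervalIntegrable _ _)
          ((hwcont.const_mul _).intervalIntegrable _ _) fun s hs => ?_
        rw [← mul_div_assoc, le_div_iff₀ (hψpos s), mul_comm (φ' _)]
        exact mul_le_mul_of_nonneg_left (hquot s hs).2 (sq_nonneg _)
    have b0 := hbounds t₀ hl
    have bt := hbounds t ht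
    rw [hIconst] at bt
    have q0 := hlow t₀ ht₀
    have qt := hlow t (hIcc ht)
    have r0 := hℓpos t₀ ht₀
    have rt := hℓpos t (hIcc ht)
    constructor
    · refine le_trans ?_ bt.1
      rw [div_mul_eq_mul_div, mul_div_assoc]
      refine mul_le_mul_of_nonneg_left ?_ (hφpos _ qt).le
      rw [div_le_iff₀ (hφpos _ (q0.trans (by linarith))), mul_comm]
      exact b0.2
    · refine bt.2.trans ?_
      rw [div_mul_eq_mul_div, mul_div_assoc]
      refine mul_le_mul_of_nonneg_left ?_ (hφpos _ (qt.trans (by linarith))).le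
      rw [le_div_iff₀ (hφpos _ q0), mul_comm]
      exact b0.1
end

section
/- Let u be a classical solution of the wave equation on 0 < x < ℓ(t) with u(0,t) = 0 and the damped boundary condition (1 + η ℓ′(t)) u_x(ℓ(t),t) + (η + ℓ′(t)) u_t(ℓ(t),t) = 0, where η > 0, η ≠ 1. If 1 + η ℓ′(t) ≠ 0 on an interval [t₁,t₂], then for all t ∈ [t₁,t₂]: E′(t) = −(1/2)(ℓ′(t) η² + 2η + ℓ′(t)) · ((1 − |ℓ′(t)|²)/(1 + η ℓ′(t))²) · u_t(ℓ(t),t)². -/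
open Set Filter Topology MeasureTheory Metric
open scoped Interval

/-- Differentiation under the integral sign on a fixed interval, for an integrand whose partial
derivative in the parameter is continuous near the segment of integration. -/
theorem hasDerivAt_integral_of_continuousOn_deriv {f g : ℝ × ℝ → ℝ} {V : Set (ℝ × ℝ)}
    (hV : IsOpen V) (hf : ContinuousOn f V) (hg : ContinuousOn g V)
    (hfg : ∀ x t, (x, t) ∈ V → HasDerivAt (fun s => f (x, s)) (g (x, t)) t)
    {a b t₀ : ℝ} (hseg : ∀ x ∈ uIcc a b, (x, t₀) ∈ V) :
    HasDerivAt (fun t => ∫ x in a..b, f (x, t)) (∫ x in a..b, g (x, t₀)) t₀ := by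
  obtain ⟨A, B, -, hB, hsA, htB, hAB⟩ :=
    generalized_tube_lemma (isCompact_uIcc (a := a) (b := b)) (isCompact_singleton (x := t₀)) hV
      (by rintro ⟨x, t⟩ ⟨hx, rfl⟩; exact hseg x hx)
  obtain ⟨r, hr, hrB⟩ := nhds_basis_closedBall.mem_iff.1 (hB.mem_nhds (htB rfl))
  have hmem : ∀ x ∈ uIcc a b, ∀ t ∈ closedBall t₀ r, (x, t) ∈ V :=
    fun x hx t ht => hAB ⟨hsA hx, hrB ht⟩
  obtain ⟨C, hC⟩ := (isCompact_uIcc.prod (isCompact_closedBall t₀ r)).exists_bound_of_continuousOn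
    (f := g) (s := uIcc a b ×ˢ closedBall t₀ r) (hg.mono fun p hp => hmem p.1 hp.1 p.2 hp.2)
  have hslice : ∀ {h : ℝ × ℝ → ℝ}, ContinuousOn h V → ∀ t ∈ closedBall t₀ r,
      ContinuousOn (fun x => h (x, t)) (uIcc a b) := fun hh t ht =>
    hh.comp (by fun_prop) fun x hx => hmem x hx t ht
  have hmeas : ∀ {h : ℝ × ℝ → ℝ}, ContinuousOn h V → ∀ t ∈ closedBall t₀ r,
      AEStronglyMeasurable (fun x => h (x, t)) (volume.restrict (Ι a b)) := fun hh t ht =>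
    ((hslice hh t ht).mono uIoc_subset_uIcc).aestronglyMeasurable measurableSet_uIoc
  have ht₀ : t₀ ∈ closedBall t₀ r := mem_closedBall_self hr.le
  refine (intervalIntegral.hasDerivAt_integral_of_dominated_loc_of_deriv_le
    (F := fun t x => f (x, t)) (F' := fun t x => g (x, t)) (bound := fun _ => C)
    (closedBall_mem_nhds t₀ hr) ?_ (hslice hf t₀ ht₀).intervalIntegrable (hmeas hg t₀ ht₀)
    ?_ intervalIntegrable_const ?_).2
  · filter_upwards [closedBall_mem_nhds t₀ hr] with t ht using hmeas hf t ht
  · exact .of_forall fun x hx t ht => hC (x, t) ⟨uIoc_subset_uIcc hx, ht⟩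
  · exact .of_forall fun x hx t ht => hfg x t (hmem x (uIoc_subset_uIcc hx) t ht)

/-- The derivative of an integral over a collapsing interval with moving endpoint. -/
theorem hasDerivAt_integral_collapsing {f : ℝ × ℝ → ℝ} {V : Set (ℝ × ℝ)} (hV : IsOpen V)
    (hf : ContinuousOn f V) {b : ℝ → ℝ} {b' t₀ : ℝ} (hb : HasDerivAt b b' t₀)
    (hmem : (b t₀, t₀) ∈ V) :
    HasDerivAt (fun t => ∫ x in b t₀..b t, f (x, t)) (b' * f (b t₀, t₀)) t₀ := by
  set c := f (b t₀, t₀)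
  have hnear : ∀ W ∈ 𝓝 (b t₀, t₀), ∀ᶠ t in 𝓝 t₀, ∀ x ∈ uIcc (b t₀) (b t), (x, t) ∈ W := by
    intro W hW
    obtain ⟨r, hr, hrW⟩ := Metric.mem_nhds_iff.1 hW
    filter_upwards [ball_mem_nhds t₀ hr, hb.continuousAt (ball_mem_nhds (b t₀) hr)]
      with t ht hbt x hx
    apply hrW
    rw [← ball_prod_same]
    exact ⟨(convex_ball (b t₀) r).ordConnected.uIcc_subset (mem_ball_self hr) hbt hx, ht⟩
  have hint : ∀ᶠ t in 𝓝 t₀, IntervalIntegrable (fun x => f (x, t)) volume (b t₀) (b t) := by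
    filter_upwards [hnear V (hV.mem_nhds hmem)] with t ht
    exact (hf.comp (by fun_prop) ht : ContinuousOn (fun x => f (x, t)) _).intervalIntegrable
  have hrem : HasDerivAt (fun t => ∫ x in b t₀..b t, (f (x, t) - c)) 0 t₀ := by
    rw [hasDerivAt_iff_isLittleO]
    simp only [intervalIntegral.integral_same, sub_zero, smul_zero]
    refine Asymptotics.IsLittleO.trans_isBigO (g := fun t => b t - b t₀) ?_ hb.isBigO_sub
    rw [Asymptotics.isLittleO_iff]
    intro ε hε
    have hW : {p | ‖f p - c‖ ≤ ε} ∈ 𝓝 (b t₀, t₀) := by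
      filter_upwards [(hf.continuousAt (hV.mem_nhds hmem)) (closedBall_mem_nhds c hε)] with p hp
      simpa [dist_eq_norm] using hp
    filter_upwards [hnear _ hW] with t ht
    exact intervalIntegral.norm_integral_le_of_norm_le_const fun x hx => ht x (uIoc_subset_uIcc hx)
  have hmain := ((hb.sub_const (b t₀)).mul_const c).add hrem
  rw [add_zero] at hmain
  refine hmain.congr_of_eventuallyEq ?_
  filter_upwards [hint] with t ht
  simp [intervalIntegral.integral_sub ht intervalIntegrable_const]

/-- Leibniz rule with a moving upper endpoint. -/
theorem hasDerivAt_integral_moving_endpoint {f g : ℝ × ℝ → ℝ} {V : Set (ℝ × ℝ)}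
    (hV : IsOpen V) (hf : ContinuousOn f V) (hg : ContinuousOn g V)
    (hfg : ∀ x t, (x, t) ∈ V → HasDerivAt (fun s => f (x, s)) (g (x, t)) t)
    {a b' t₀ : ℝ} {b : ℝ → ℝ} (hb : HasDerivAt b b' t₀)
    (hseg : ∀ᶠ t in 𝓝 t₀, ∀ x ∈ uIcc a (b t) ∪ uIcc a (b t₀), (x, t) ∈ V) :
    HasDerivAt (fun t => ∫ x in a..b t, f (x, t))
      ((∫ x in a..b t₀, g (x, t₀)) + b' * f (b t₀, t₀)) t₀ := by
  have hseg₀ := hseg.self_of_nhds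
  refine ((hasDerivAt_integral_of_continuousOn_deriv hV hf hg hfg
    fun x hx => hseg₀ x (.inl hx)).add
      (hasDerivAt_integral_collapsing hV hf hb
        (hseg₀ _ (.inl right_mem_uIcc)))).congr_of_eventuallyEq ?_
  filter_upwards [hseg] with t ht
  have hint : ∀ y, uIcc a y ⊆ uIcc a (b t) ∪ uIcc a (b t₀) →
      IntervalIntegrable (fun x => f (x, t)) volume a y := fun y hy =>
    (hf.comp (by fun_prop) fun x hx => ht x (hy hx) :
      ContinuousOn (fun x => f (x, t)) _).intervalIntegrable
  have h₀ := hint _ subset_union_right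
  exact (intervalIntegral.integral_add_adjacent_intervals h₀
    (h₀.symm.trans (hint _ subset_union_left))).symm

/-- Restriction of a differentiable function of two variables to a vertical line. -/
theorem HasFDerivAt.hasDerivAt_vertical {F : Type*} [NormedAddCommGroup F] [NormedSpace ℝ F]
    {v : ℝ × ℝ → F} {L : ℝ × ℝ →L[ℝ] F} {x t : ℝ} (h : HasFDerivAt v L (x, t)) :
    HasDerivAt (fun s => v (x, s)) (L (0, 1)) t :=
  h.comp_hasDerivAt t ((hasDerivAt_const t x).prodMk (hasDerivAt_id t))

/-- Restriction of a differentiable function of two variables to a horizontal line. -/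
theorem HasFDerivAt.hasDerivAt_horizontal {F : Type*} [NormedAddCommGroup F] [NormedSpace ℝ F]
    {v : ℝ × ℝ → F} {L : ℝ × ℝ →L[ℝ] F} {x t : ℝ} (h : HasFDerivAt v L (x, t)) :
    HasDerivAt (fun y => v (y, t)) (L (1, 0)) x :=
  h.comp_hasDerivAt x ((hasDerivAt_id x).prodMk (hasDerivAt_const x t))


theorem damped_energy_derivative
    (ℓ ℓ' : ℝ → ℝ)
    (hℓC1 : ContDiffOn ℝ 1 ℓ (Set.Ici 0))
    (hℓd : ∀ t ∈ Set.Ici (0:ℝ), HasDerivWithinAt ℓ (ℓ' t) (Set.Ici 0) t)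
    (hℓpos : ∀ t ∈ Set.Ici (0:ℝ), 0 < ℓ t)
    (hℓspeed : ∀ t ∈ Set.Ici (0:ℝ), |ℓ' t| < 1)
    (u : ℝ → ℝ → ℝ) (U : Set (ℝ × ℝ)) (hUopen : IsOpen U)
    (hUK : {p : ℝ × ℝ | 0 ≤ p.2 ∧ p.1 ∈ Set.Icc 0 (ℓ p.2)} ⊆ U)
    (huC2 : ContDiffOn ℝ 2 (fun p : ℝ × ℝ => u p.1 p.2) U)
    (hwave : ∀ x t : ℝ, 0 ≤ t → x ∈ Set.Icc 0 (ℓ t) →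
      deriv (deriv (u x)) t = deriv (deriv (fun y => u y t)) x)
    (hbc0 : ∀ t : ℝ, 0 ≤ t → u 0 t = 0)
    (η : ℝ) (hη0 : 0 < η) (hη1 : η ≠ 1)
    (hbcℓ : ∀ t : ℝ, 0 < t →
      (1 + η * ℓ' t) * deriv (fun y => u y t) (ℓ t)
        + (η + ℓ' t) * deriv (u (ℓ t)) t = 0)
    (E : ℝ → ℝ)
    (hE : ∀ t : ℝ, E t = (1/2) * ∫ x in (0:ℝ)..(ℓ t),
      ((deriv (u x) t)^2 + (deriv (fun y => u y t) x)^2))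
    (t₁ t₂ : ℝ) (ht₁ : 0 < t₁)
    (hne : ∀ t ∈ Set.Icc t₁ t₂, 1 + η * ℓ' t ≠ 0)
    : ∀ t ∈ Set.Icc t₁ t₂, HasDerivAt E
      (-(1/2) * (ℓ' t * η^2 + 2 * η + ℓ' t)
        * ((1 - |ℓ' t|^2) / (1 + η * ℓ' t)^2) * (deriv (u (ℓ t)) t)^2) t := by
  intro t₀ ht₀
  have ht₀pos : 0 < t₀ := ht₁.trans_le ht₀.1
  set v : ℝ × ℝ → ℝ := fun p => u p.1 p.2
  set D := fderiv ℝ v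
  have hDC1 : ContDiffOn ℝ 1 D U := huC2.fderiv_of_isOpen hUopen (by norm_num)
  have hD2c : ContinuousOn (fderiv ℝ D) U := hDC1.continuousOn_fderiv_of_isOpen hUopen le_rfl
  have hDc : ContinuousOn D U := hDC1.continuousOn
  have hvd : ∀ p ∈ U, HasFDerivAt v (D p) p := fun p hp =>
    ((huC2.contDiffAt (hUopen.mem_nhds hp)).differentiableAt (by norm_num)).hasFDerivAt
  have hDd : ∀ p ∈ U, HasFDerivAt D (fderiv ℝ D p) p := fun p hp =>
    ((hDC1.contDiffAt (hUopen.mem_nhds hp)).differentiableAt (by norm_num)).hasFDerivAt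
  have hut : ∀ x t, (x, t) ∈ U → deriv (u x) t = D (x, t) (0, 1) := fun x t hp =>
    (hvd _ hp).hasDerivAt_vertical.deriv
  have hux : ∀ x t, (x, t) ∈ U → deriv (fun y => u y t) x = D (x, t) (1, 0) := fun x t hp =>
    (hvd _ hp).hasDerivAt_horizontal.deriv
  have hDt : ∀ x t w, (x, t) ∈ U →
      HasDerivAt (fun s => D (x, s) w) (fderiv ℝ D (x, t) (0, 1) w) t := fun x t w hp =>
    ((hDd _ hp).hasDerivAt_vertical.clm_apply (hasDerivAt_const t w)).congr_deriv (by simp)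
  have hDx : ∀ x t w, (x, t) ∈ U →
      HasDerivAt (fun y => D (y, t) w) (fderiv ℝ D (x, t) (1, 0) w) x := fun x t w hp =>
    ((hDd _ hp).hasDerivAt_horizontal.clm_apply (hasDerivAt_const x w)).congr_deriv (by simp)
  have hsymm : ∀ p ∈ U, fderiv ℝ D p (0, 1) (1, 0) = fderiv ℝ D p (1, 0) (0, 1) := fun p hp =>
    (huC2.contDiffAt (hUopen.mem_nhds hp)).isSymmSndFDerivAt (by simp) _ _
  have hK : ∀ x t, 0 ≤ t → x ∈ Icc 0 (ℓ t) → (x, t) ∈ U := fun x t ht hx => hUK ⟨ht, hx⟩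
  have hw : ∀ x t, 0 ≤ t → x ∈ Icc 0 (ℓ t) →
      fderiv ℝ D (x, t) (0, 1) (0, 1) = fderiv ℝ D (x, t) (1, 0) (1, 0) := by
    intro x t ht hx
    have hp := hK x t ht hx
    have hUn := hUopen.mem_nhds hp
    have htt : deriv (deriv (u x)) t = fderiv ℝ D (x, t) (0, 1) (0, 1) := by
      rw [← (hDt x t (0, 1) hp).deriv]
      apply EventuallyEq.deriv_eq
      filter_upwards [(by fun_prop : ContinuousAt (fun s => (x, s)) t) hUn] with s hs
        using hut x s hs
    have hxx : deriv (deriv (fun y => u y t)) x = fderiv ℝ D (x, t) (1, 0) (1, 0) := by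
      rw [← (hDx x t (1, 0) hp).deriv]
      apply EventuallyEq.deriv_eq
      filter_upwards [(by fun_prop : ContinuousAt (fun y => (y, t)) x) hUn] with y hy
        using hux y t hy
    rw [← htt, ← hxx, hwave x t ht hx]
  have hℓ₀ : HasDerivAt ℓ (ℓ' t₀) t₀ := (hℓd t₀ ht₀pos.le).hasDerivAt (Ici_mem_nhds ht₀pos)
  have hpos₀ := hℓpos t₀ ht₀pos.le
  have hIcc : ∀ t, 0 ≤ t → uIcc 0 (ℓ t) = Icc 0 (ℓ t) := fun t ht => uIcc_of_le (hℓpos t ht).le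
  have hseg : ∀ᶠ t in 𝓝 t₀, ∀ x ∈ uIcc 0 (ℓ t) ∪ uIcc 0 (ℓ t₀), (x, t) ∈ U := by
    obtain ⟨A, B, -, hB, hsA, htB, hAB⟩ :=
      generalized_tube_lemma (isCompact_uIcc (a := 0) (b := ℓ t₀)) (isCompact_singleton (x := t₀))
        hUopen (by rintro ⟨x, t⟩ ⟨hx, rfl⟩; exact hK x t ht₀pos.le (hIcc t ht₀pos.le ▸ hx))
    filter_upwards [Ici_mem_nhds ht₀pos, hB.mem_nhds (htB rfl)] with t ht htB x hx
    rcases hx with hx | hx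
    · exact hK x t ht (hIcc t ht ▸ hx)
    · exact hAB ⟨hsA hx, htB⟩
  have hLeibniz := hasDerivAt_integral_moving_endpoint
    (f := fun p => D p (0, 1) ^ 2 + D p (1, 0) ^ 2)
    (g := fun p => 2 * D p (0, 1) * fderiv ℝ D p (0, 1) (0, 1)
      + 2 * D p (1, 0) * fderiv ℝ D p (0, 1) (1, 0))
    hUopen (by fun_prop) (by fun_prop)
    (fun x t hp => (((hDt x t (0, 1) hp).pow 2).add ((hDt x t (1, 0) hp).pow 2)).congr_deriv
      (by simp)) hℓ₀ hseg
  have hflux : ∫ x in 0..ℓ t₀, (2 * D (x, t₀) (0, 1) * fderiv ℝ D (x, t₀) (0, 1) (0, 1)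
      + 2 * D (x, t₀) (1, 0) * fderiv ℝ D (x, t₀) (0, 1) (1, 0))
      = 2 * (D (ℓ t₀, t₀) (0, 1) * D (ℓ t₀, t₀) (1, 0))
        - 2 * (D (0, t₀) (0, 1) * D (0, t₀) (1, 0)) := by
    refine intervalIntegral.integral_eq_sub_of_hasDerivAt
      (f := fun x => 2 * (D (x, t₀) (0, 1) * D (x, t₀) (1, 0))) (fun x hx => ?_) ?_
    · rw [hIcc t₀ ht₀pos.le] at hx
      have hp := hK x t₀ ht₀pos.le hx
      refine (((hDx x t₀ (0, 1) hp).mul (hDx x t₀ (1, 0) hp)).const_mul 2).congr_deriv ?_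
      rw [hw x t₀ ht₀pos.le hx, hsymm _ hp]
      ring
    · apply ContinuousOn.intervalIntegrable
      have hmaps : MapsTo (fun x => (x, t₀)) (uIcc 0 (ℓ t₀)) U := fun x hx =>
        hseg.self_of_nhds x (.inl hx)
      have h₁ : ContinuousOn (fun x => D (x, t₀)) (uIcc 0 (ℓ t₀)) := hDc.comp (by fun_prop) hmaps
      have h₂ : ContinuousOn (fun x => fderiv ℝ D (x, t₀)) (uIcc 0 (ℓ t₀)) :=
        hD2c.comp (by fun_prop) hmaps
      fun_prop
  have hleft : D (0, t₀) (0, 1) = 0 := by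
    rw [← hut 0 t₀ (hK 0 t₀ ht₀pos.le ⟨le_rfl, hpos₀.le⟩)]
    have : u 0 =ᶠ[𝓝 t₀] fun _ => 0 := by
      filter_upwards [Ici_mem_nhds ht₀pos] with t ht using hbc0 t ht
    simpa using this.deriv_eq
  have hpℓ := hK (ℓ t₀) t₀ ht₀pos.le ⟨hpos₀.le, le_rfl⟩
  have hbc := hbcℓ t₀ ht₀pos
  rw [hux _ _ hpℓ, hut _ _ hpℓ] at hbc
  have hE' : E =ᶠ[𝓝 t₀] fun t =>
      (1/2) * ∫ x in 0..ℓ t, (D (x, t) (0, 1) ^ 2 + D (x, t) (1, 0) ^ 2) := by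
    filter_upwards [hseg] with t ht
    rw [hE]
    congr 1
    refine intervalIntegral.integral_congr fun x hx => ?_
    simp only [hut x t (ht x (.inl hx)), hux x t (ht x (.inl hx))]
  refine ((hLeibniz.const_mul (1/2)).congr_of_eventuallyEq hE').congr_deriv ?_
  rw [hflux, hleft, hut _ _ hpℓ, sq_abs]
  have ha := hne t₀ ht₀
  have hsol : D (ℓ t₀, t₀) (1, 0)
      = -((η + ℓ' t₀) * D (ℓ t₀, t₀) (0, 1)) / (1 + η * ℓ' t₀) := by
    rw [eq_div_iff ha]
    linarith
  rw [hsol]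
  field_simp
  ring
end

section
/- Let u be a classical solution of the wave equation on 0 < x < ℓ(t) with u(0,t) = 0 and the damped boundary condition (1 + η ℓ′(t)) u_x(ℓ(t),t) + (η + ℓ′(t)) u_t(ℓ(t),t) = 0, with η > 0, η ≠ 1. Suppose −1 < ℓ′(t) < 0 and 1 + η ℓ′(t) ≠ 0 for t in an interval [t₁,t₂], and set η₁(t) = (−1 + √(1 − ℓ′(t)²))/ℓ′(t), η₂(t) = (−1 − √(1 − ℓ′(t)²))/ℓ′(t). Then for t ∈ [t₁,t₂]: if η₁(t) < η < η₂(t) then E′(t) ≤ 0; if η = η₁(t) or η = η₂(t) then E′(t) = 0; and if 0 < η < η₁(t) or η > η₂(t) then E′(t) ≥ 0. -/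
open Set Filter Topology

/-- Transport theorem for a density `e` and a flux `m` satisfying `∂ₜ e = ∂ₓ m` at time `t`,
on the interval `[0, L s]` with a moving right endpoint. -/
lemma hasDerivAt_integral_moving_endpoint_s12 {e m : ℝ × ℝ → ℝ} {U : Set (ℝ × ℝ)} (hU : IsOpen U)
    (he : ContDiffOn ℝ 1 e U) (hm : ContDiffOn ℝ 1 m U) {L L' : ℝ → ℝ} {t δ C : ℝ} (hδ : 0 < δ)
    (hL : ∀ s ∈ Icc (t - δ) (t + δ), HasDerivAt L (L' s) s)
    (hC : ∀ s ∈ Icc (t - δ) (t + δ), |L' s| ≤ C)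
    (hpos : ∀ s ∈ Icc (t - δ) (t + δ), 0 ≤ L s)
    (hsub : ∀ s ∈ Icc (t - δ) (t + δ), ∀ x ∈ Icc 0 (L s), (x, s) ∈ U)
    (hcons : ∀ x ∈ Icc 0 (L t), fderiv ℝ e (x, t) (0, 1) = fderiv ℝ m (x, t) (1, 0)) :
    HasDerivAt (fun s => ∫ x in (0 : ℝ)..L s, e (x, s))
      (L' t * e (L t, t) + (m (L t, t) - m (0, t))) t := by
  have ht : t ∈ Icc (t - δ) (t + δ) := ⟨by linarith, by linarith⟩
  have hmul : ∀ s ∈ Icc (t - δ) (t + δ), ∀ y ∈ Icc (0 : ℝ) 1, (y * L s, s) ∈ U := fun s hs y hy =>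
    hsub s hs _ ⟨mul_nonneg hy.1 (hpos s hs), mul_le_of_le_one_left (hpos s hs) hy.2⟩
  have hdiff : ∀ {g : ℝ × ℝ → ℝ}, ContDiffOn ℝ 1 g U → ∀ p ∈ U, HasFDerivAt g (fderiv ℝ g p) p :=
    fun hg p hp => ((hg.differentiableOn one_ne_zero).differentiableAt
      (hU.mem_nhds hp)).hasFDerivAt
  have hLcont : ContinuousOn L (Icc (t - δ) (t + δ)) := fun s hs =>
    (hL s hs).continuousAt.continuousWithinAt
  have hde : ContinuousOn (fderiv ℝ e) U := he.continuousOn_fderiv_of_isOpen hU le_rfl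
  have hcompact : IsCompact (Icc (0 : ℝ) 1 ×ˢ Icc (t - δ) (t + δ)) :=
    isCompact_Icc.prod isCompact_Icc
  have hmap : ContinuousOn (fun z : ℝ × ℝ => (z.1 * L z.2, z.2))
      (Icc (0 : ℝ) 1 ×ˢ Icc (t - δ) (t + δ)) :=
    (continuousOn_fst.mul (hLcont.comp continuousOn_snd fun z hz => hz.2)).prodMk continuousOn_snd
  have hmaps : MapsTo (fun z : ℝ × ℝ => (z.1 * L z.2, z.2))
      (Icc (0 : ℝ) 1 ×ˢ Icc (t - δ) (t + δ)) U := fun z hz => hmul z.2 hz.2 z.1 hz.1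
  obtain ⟨A, hA⟩ := hcompact.exists_bound_of_continuousOn (hde.comp hmap hmaps)
  obtain ⟨B, hB⟩ := hcompact.exists_bound_of_continuousOn (he.continuousOn.comp hmap hmaps)
  obtain ⟨D, hD⟩ := isCompact_Icc.exists_bound_of_continuousOn hLcont
  have hslice : ∀ s ∈ Icc (t - δ) (t + δ),
      ContinuousOn (fun y : ℝ => (y * L s, s)) (Icc (0 : ℝ) 1) := fun s _ => by fun_prop
  set F : ℝ → ℝ → ℝ := fun s y => e (y * L s, s) * L s with hF
  set F' : ℝ → ℝ → ℝ := fun s y =>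
    fderiv ℝ e (y * L s, s) (y * L' s, 1) * L s + e (y * L s, s) * L' s with hF'
  have hFcont : ∀ s ∈ Icc (t - δ) (t + δ), ContinuousOn (F s) (Icc 0 1) := fun s hs =>
    (he.continuousOn.comp (hslice s hs) (hmul s hs)).mul continuousOn_const
  have hF'cont : ContinuousOn (F' t) (Icc 0 1) :=
    (((hde.comp (hslice t ht) (hmul t ht)).clm_apply (by fun_prop)).mul continuousOn_const).add
      ((he.continuousOn.comp (hslice t ht) (hmul t ht)).mul continuousOn_const)
  have hIoc : uIoc (0 : ℝ) 1 ⊆ Icc 0 1 := by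
    rw [uIoc_of_le zero_le_one]; exact Ioc_subset_Icc_self
  have hnhds : Icc (t - δ) (t + δ) ∈ 𝓝 t := Icc_mem_nhds (by linarith) (by linarith)
  have hint : ∀ {g : ℝ → ℝ}, ContinuousOn g (Icc 0 1) →
      IntervalIntegrable g MeasureTheory.volume 0 1 :=
    fun hg => hg.intervalIntegrable_of_Icc zero_le_one
  have hmain := (intervalIntegral.hasDerivAt_integral_of_dominated_loc_of_deriv_le
    (μ := MeasureTheory.volume) (F := F) (F' := F') (a := 0) (b := 1) (x₀ := t)
    (bound := fun _ => A * max C 1 * D + B * C) hnhds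
    (by
      filter_upwards [hnhds] with s hs
      exact ((hFcont s hs).mono hIoc).aestronglyMeasurable measurableSet_uIoc)
    (hint (hFcont t ht))
    ((hF'cont.mono hIoc).aestronglyMeasurable measurableSet_uIoc)
    (by
      refine Eventually.of_forall fun y hy s hs => ?_
      have hy' := hIoc hy
      have h1 : ‖fderiv ℝ e (y * L s, s)‖ ≤ A := hA (y, s) ⟨hy', hs⟩
      have h2 : ‖e (y * L s, s)‖ ≤ B := hB (y, s) ⟨hy', hs⟩
      have h3 : ‖L s‖ ≤ D := hD s hs
      have h4 : ‖L' s‖ ≤ C := hC s hs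
      have hA0 : 0 ≤ A := (norm_nonneg _).trans h1
      have hB0 : 0 ≤ B := (norm_nonneg _).trans h2
      have h5 : ‖((y * L' s, 1) : ℝ × ℝ)‖ ≤ max C 1 := by
        rw [Prod.norm_mk, norm_one, norm_mul, Real.norm_of_nonneg hy'.1]
        exact max_le_max ((mul_le_of_le_one_left (norm_nonneg _) hy'.2).trans h4) le_rfl
      have h6 := (fderiv ℝ e (y * L s, s)).le_opNorm (y * L' s, 1)
      calc ‖F' s y‖ ≤ ‖fderiv ℝ e (y * L s, s) (y * L' s, 1)‖ * ‖L s‖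
            + ‖e (y * L s, s)‖ * ‖L' s‖ := by
            rw [← norm_mul, ← norm_mul]; exact norm_add_le _ _
        _ ≤ ‖fderiv ℝ e (y * L s, s)‖ * ‖((y * L' s, 1) : ℝ × ℝ)‖ * ‖L s‖
            + ‖e (y * L s, s)‖ * ‖L' s‖ := by gcongr
        _ ≤ _ := by gcongr)
    intervalIntegrable_const
    (by
      refine Eventually.of_forall fun y hy s hs => ?_
      have hcurve : HasDerivAt (fun r => (y * L r, r)) (y * L' s, (1 : ℝ)) s :=
        ((hL s hs).const_mul y).prodMk (hasDerivAt_id s)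
      exact (HasFDerivAt.comp_hasDerivAt s (f := fun r => (y * L r, r))
        (hdiff he _ (hmul s hs y (hIoc hy))) hcurve).mul (hL s hs))).2
  have hFTC : ∫ y in (0 : ℝ)..1, F' t y = L' t * e (L t, t) + (m (L t, t) - m (0, t)) := by
    rw [intervalIntegral.integral_eq_sub_of_hasDerivAt
      (f := fun y => L' t * (y * e (y * L t, t)) + m (y * L t, t)) (fun y hy => ?_) (hint hF'cont)]
    · simp; ring
    · rw [uIcc_of_le zero_le_one] at hy
      have hyU := hmul t ht y hy
      have hcurve : HasDerivAt (fun r => (r * L t, t)) (L t, (0 : ℝ)) y := by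
        simpa using ((hasDerivAt_id y).mul_const (L t)).prodMk (hasDerivAt_const y t)
      have hd := (((hasDerivAt_id y).mul
        ((hdiff he _ hyU).comp_hasDerivAt y hcurve)).const_mul (L' t)).add
        ((hdiff hm _ hyU).comp_hasDerivAt y hcurve)
      refine hd.congr_deriv ?_
      have hc := hcons (y * L t)
        ⟨mul_nonneg hy.1 (hpos t ht), mul_le_of_le_one_left (hpos t ht) hy.2⟩
      have hv1 : ((L t, 0) : ℝ × ℝ) = L t • ((1, 0) : ℝ × ℝ) := by simp
      have hv2 : ((y * L' t, 1) : ℝ × ℝ) = (y * L' t) • ((1, 0) : ℝ × ℝ) + (0, 1) := by simp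
      simp only [hF', hv1, hv2, map_add, map_smul, smul_eq_mul, hc, id_eq, Function.comp_apply]
      ring
  rw [← hFTC]
  refine hmain.congr_of_eventuallyEq (Eventually.of_forall fun s => ?_)
  have := intervalIntegral.smul_integral_comp_mul_right (a := 0) (b := 1) (fun x => e (x, s)) (L s)
  simp only [zero_mul, one_mul, smul_eq_mul] at this
  simp only [hF, intervalIntegral.integral_mul_const, ← this]
  exact mul_comm _ _

lemma deriv_fst_slice {u : ℝ → ℝ → ℝ} {x t : ℝ}
    (h : DifferentiableAt ℝ (fun p : ℝ × ℝ => u p.1 p.2) (x, t)) :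
    deriv (fun y => u y t) x = fderiv ℝ (fun p : ℝ × ℝ => u p.1 p.2) (x, t) (1, 0) :=
  (HasFDerivAt.comp_hasDerivAt x (f := fun y => (y, t)) h.hasFDerivAt ((hasDerivAt_id x).prodMk
    (hasDerivAt_const x t))).deriv

lemma deriv_snd_slice {u : ℝ → ℝ → ℝ} {x t : ℝ}
    (h : DifferentiableAt ℝ (fun p : ℝ × ℝ => u p.1 p.2) (x, t)) :
    deriv (u x) t = fderiv ℝ (fun p : ℝ × ℝ => u p.1 p.2) (x, t) (0, 1) :=
  (h.hasFDerivAt.comp_hasDerivAt t ((hasDerivAt_const t x).prodMk (hasDerivAt_id t))).deriv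

/-- Energy balance for the wave equation on `[0, ℓ t]`, fixed at the left endpoint. -/
lemma hasDerivAt_wave_energy {ℓ ℓ' : ℝ → ℝ}
    (hℓd : ∀ t ∈ Ici (0 : ℝ), HasDerivWithinAt ℓ (ℓ' t) (Ici 0) t)
    (hℓpos : ∀ t ∈ Ici (0 : ℝ), 0 < ℓ t) (hℓspeed : ∀ t ∈ Ici (0 : ℝ), |ℓ' t| < 1)
    {u : ℝ → ℝ → ℝ} {U : Set (ℝ × ℝ)} (hU : IsOpen U)
    (hUK : {p : ℝ × ℝ | 0 ≤ p.2 ∧ p.1 ∈ Icc 0 (ℓ p.2)} ⊆ U)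
    (hu : ContDiffOn ℝ 2 (fun p : ℝ × ℝ => u p.1 p.2) U)
    (hwave : ∀ x t : ℝ, 0 ≤ t → x ∈ Icc 0 (ℓ t) →
      deriv (deriv (u x)) t = deriv (deriv (fun y => u y t)) x)
    (hbc0 : ∀ t : ℝ, 0 ≤ t → u 0 t = 0) {t : ℝ} (ht : 0 < t) :
    HasDerivAt (fun s => ∫ x in (0 : ℝ)..ℓ s,
        ((deriv (u x) s) ^ 2 + (deriv (fun y => u y s) x) ^ 2))
      (ℓ' t * ((deriv (u (ℓ t)) t) ^ 2 + (deriv (fun y => u y t) (ℓ t)) ^ 2)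
        + 2 * deriv (fun y => u y t) (ℓ t) * deriv (u (ℓ t)) t) t := by
  set f : ℝ × ℝ → ℝ := fun p => u p.1 p.2 with hf
  have hdf : ∀ p ∈ U, DifferentiableAt ℝ f p := fun p hp =>
    (hu.differentiableOn two_ne_zero).differentiableAt (hU.mem_nhds hp)
  have hgrad : ContDiffOn ℝ 1 (fderiv ℝ f) U := hu.fderiv_of_isOpen hU (by norm_num)
  set P : ℝ × ℝ → ℝ := fun p => fderiv ℝ f p (1, 0) with hP
  set Q : ℝ × ℝ → ℝ := fun p => fderiv ℝ f p (0, 1) with hQ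
  have hPc : ContDiffOn ℝ 1 P U := hgrad.clm_apply contDiffOn_const
  have hQc : ContDiffOn ℝ 1 Q U := hgrad.clm_apply contDiffOn_const
  have hdiff : ∀ {g : ℝ × ℝ → ℝ}, ContDiffOn ℝ 1 g U → ∀ p ∈ U, DifferentiableAt ℝ g p :=
    fun hg p hp => (hg.differentiableOn one_ne_zero).differentiableAt (hU.mem_nhds hp)
  have hux : ∀ x s, (x, s) ∈ U → deriv (fun y => u y s) x = P (x, s) := fun x s h =>
    deriv_fst_slice (hdf _ h)
  have hut : ∀ x s, (x, s) ∈ U → deriv (u x) s = Q (x, s) := fun x s h =>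
    deriv_snd_slice (hdf _ h)
  have hmem : ∀ s, 0 ≤ s → ∀ x ∈ Icc 0 (ℓ s), (x, s) ∈ U := fun s hs x hx => hUK ⟨hs, hx⟩
  have huxx : ∀ x s, (x, s) ∈ U →
      deriv (deriv (fun y => u y s)) x = fderiv ℝ P (x, s) (1, 0) := fun x s h => by
    rw [← deriv_fst_slice (u := fun a b => P (a, b)) (hdiff hPc _ h)]
    refine EventuallyEq.deriv_eq ?_
    have hc : ContinuousAt (fun y : ℝ => (y, s)) x := by fun_prop
    filter_upwards [hc (hU.mem_nhds h)] with y hy using hux y s hy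
  have hutt : ∀ x s, (x, s) ∈ U →
      deriv (deriv (u x)) s = fderiv ℝ Q (x, s) (0, 1) := fun x s h => by
    rw [← deriv_snd_slice (u := fun a b => Q (a, b)) (hdiff hQc _ h)]
    refine EventuallyEq.deriv_eq ?_
    have hc : ContinuousAt (fun r : ℝ => (x, r)) s := by fun_prop
    filter_upwards [hc (hU.mem_nhds h)] with r hr using hut x r hr
  have happly : ∀ p ∈ U, ∀ v w : ℝ × ℝ,
      fderiv ℝ (fun q => fderiv ℝ f q v) p w = fderiv ℝ (fderiv ℝ f) p w v := fun p hp v w => by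
    have hg := (hgrad.differentiableOn one_ne_zero).differentiableAt (hU.mem_nhds hp)
    rw [fderiv_clm_apply hg (differentiableAt_const v)]
    simp
  have hsymm : ∀ p ∈ U, fderiv ℝ P p (0, 1) = fderiv ℝ Q p (1, 0) := fun p hp => by
    rw [happly p hp, happly p hp]
    exact ((hu.contDiffAt (hU.mem_nhds hp)).isSymmSndFDerivAt (by simp)) _ _
  have hnear : ∀ s ∈ Icc (t - t / 2) (t + t / 2), 0 < s := fun s hs => by linarith [hs.1]
  have hmain := hasDerivAt_integral_moving_endpoint_s12 (e := fun p => Q p ^ 2 + P p ^ 2)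
    (m := fun p => 2 * P p * Q p) (L := ℓ) (L' := ℓ') (t := t) (δ := t / 2) (C := 1) hU
    ((hQc.pow 2).add (hPc.pow 2)) ((contDiffOn_const.mul hPc).mul hQc) (by linarith)
    (fun s hs => (hℓd s (hnear s hs).le).hasDerivAt (Ici_mem_nhds (hnear s hs)))
    (fun s hs => (hℓspeed s (hnear s hs).le).le) (fun s hs => (hℓpos s (hnear s hs).le).le)
    (fun s hs => hmem s (hnear s hs).le)
    (fun x hx => by
      have hxU := hmem t ht.le x hx
      have hw := hwave x t ht.le hx
      rw [hutt x t hxU, huxx x t hxU] at hw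
      have hs := hsymm _ hxU
      have hp := (hdiff hPc _ hxU).hasFDerivAt
      have hq := (hdiff hQc _ hxU).hasFDerivAt
      have hde : HasFDerivAt (fun p => Q p ^ 2 + P p ^ 2) _ (x, t) := (hq.pow 2).add (hp.pow 2)
      have hdm : HasFDerivAt (fun p => 2 * P p * Q p) _ (x, t) := (hp.const_mul 2).mul hq
      rw [hde.fderiv, hdm.fderiv]
      simp [hw, hs]
      ring)
  have hQ0 : Q (0, t) = 0 := by
    rw [← hut 0 t (hmem t ht.le 0 ⟨le_rfl, (hℓpos t ht.le).le⟩)]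
    have h0 : u 0 =ᶠ[𝓝 t] fun _ => (0 : ℝ) := by
      filter_upwards [Ioi_mem_nhds ht] with s hs using hbc0 s (le_of_lt hs)
    rw [h0.deriv_eq, deriv_const]
  have hend := hmem t ht.le (ℓ t) ⟨(hℓpos t ht.le).le, le_rfl⟩
  rw [hux _ _ hend, hut _ _ hend]
  simp only [hQ0, mul_zero, sub_zero] at hmain
  refine hmain.congr_of_eventuallyEq ?_
  filter_upwards [Ioi_mem_nhds ht] with s hs
  refine intervalIntegral.integral_congr fun x hx => ?_
  have hs0 : 0 ≤ s := le_of_lt hs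
  rw [uIcc_of_le (hℓpos s hs0).le] at hx
  have hxU := hmem s hs0 x hx
  simp only [hux x s hxU, hut x s hxU]

theorem damped_shrinking_energy_sign
    (ℓ ℓ' : ℝ → ℝ)
    (hℓC1 : ContDiffOn ℝ 1 ℓ (Set.Ici 0))
    (hℓd : ∀ t ∈ Set.Ici (0:ℝ), HasDerivWithinAt ℓ (ℓ' t) (Set.Ici 0) t)
    (hℓpos : ∀ t ∈ Set.Ici (0:ℝ), 0 < ℓ t)
    (hℓspeed : ∀ t ∈ Set.Ici (0:ℝ), |ℓ' t| < 1)
    (u : ℝ → ℝ → ℝ) (U : Set (ℝ × ℝ)) (hUopen : IsOpen U)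
    (hUK : {p : ℝ × ℝ | 0 ≤ p.2 ∧ p.1 ∈ Set.Icc 0 (ℓ p.2)} ⊆ U)
    (huC2 : ContDiffOn ℝ 2 (fun p : ℝ × ℝ => u p.1 p.2) U)
    (hwave : ∀ x t : ℝ, 0 ≤ t → x ∈ Set.Icc 0 (ℓ t) →
      deriv (deriv (u x)) t = deriv (deriv (fun y => u y t)) x)
    (hbc0 : ∀ t : ℝ, 0 ≤ t → u 0 t = 0)
    (η : ℝ) (hη0 : 0 < η) (hη1 : η ≠ 1)
    (hbcℓ : ∀ t : ℝ, 0 < t →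
      (1 + η * ℓ' t) * deriv (fun y => u y t) (ℓ t)
        + (η + ℓ' t) * deriv (u (ℓ t)) t = 0)
    (E : ℝ → ℝ)
    (hE : ∀ t : ℝ, E t = (1/2) * ∫ x in (0:ℝ)..(ℓ t),
      ((deriv (u x) t)^2 + (deriv (fun y => u y t) x)^2))
    (t₁ t₂ : ℝ) (ht₁ : 0 < t₁)
    (hshr : ∀ t ∈ Set.Icc t₁ t₂, -1 < ℓ' t ∧ ℓ' t < 0)
    (hne : ∀ t ∈ Set.Icc t₁ t₂, 1 + η * ℓ' t ≠ 0)
    (η₁ η₂ : ℝ → ℝ)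
    (hη₁ : ∀ t : ℝ, η₁ t = (-1 + Real.sqrt (1 - (ℓ' t)^2)) / ℓ' t)
    (hη₂ : ∀ t : ℝ, η₂ t = (-1 - Real.sqrt (1 - (ℓ' t)^2)) / ℓ' t)
    : ∀ t ∈ Set.Icc t₁ t₂,
      (η₁ t < η ∧ η < η₂ t → deriv E t ≤ 0) ∧
      (η = η₁ t ∨ η = η₂ t → deriv E t = 0) ∧
      ((0 < η ∧ η < η₁ t) ∨ η₂ t < η → 0 ≤ deriv E t) := by
  intro t ht
  have ht0 : 0 < t := ht₁.trans_le ht.1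
  obtain ⟨hl1, hl0⟩ := hshr t ht
  have hbc := hbcℓ t ht0
  have ha := hne t ht
  have hderiv : deriv E t = (1 / 2) *
      (ℓ' t * ((deriv (u (ℓ t)) t) ^ 2 + (deriv (fun y => u y t) (ℓ t)) ^ 2)
        + 2 * deriv (fun y => u y t) (ℓ t) * deriv (u (ℓ t)) t) := by
    rw [funext hE]
    exact ((hasDerivAt_wave_energy hℓd hℓpos hℓspeed hUopen hUK huC2 hwave hbc0 ht0).const_mul
      (1 / 2)).deriv
  have h₁ := hη₁ t
  have h₂ := hη₂ t
  generalize deriv (u (ℓ t)) t = q at *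
  generalize deriv (fun y => u y t) (ℓ t) = p at *
  generalize ℓ' t = l at *
  have hsq : Real.sqrt (1 - l ^ 2) ^ 2 = 1 - l ^ 2 := Real.sq_sqrt (by nlinarith)
  have hr : 0 ≤ Real.sqrt (1 - l ^ 2) := Real.sqrt_nonneg _
  generalize Real.sqrt (1 - l ^ 2) = r at *
  have hfactor : deriv E t =
      q ^ 2 * (1 - l ^ 2) * (-l) / (2 * (1 + η * l) ^ 2) * ((η - η₁ t) * (η - η₂ t)) := by
    have hp : p = -((η + l) * q) / (1 + η * l) := by
      rw [eq_div_iff ha]; linarith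
    have hvieta : (-l) * ((η - η₁ t) * (η - η₂ t)) = -(l * η ^ 2 + 2 * η + l) := by
      rw [h₁, h₂]
      field_simp [hl0.ne]
      linear_combination hsq
    have hrw : q ^ 2 * (1 - l ^ 2) * (-l) / (2 * (1 + η * l) ^ 2) * ((η - η₁ t) * (η - η₂ t)) =
        q ^ 2 * (1 - l ^ 2) / (2 * (1 + η * l) ^ 2) * ((-l) * ((η - η₁ t) * (η - η₂ t))) := by
      ring
    have ha' : 1 + l * η ≠ 0 := by rwa [mul_comm l]
    rw [hrw, hvieta, hderiv, hp]
    field_simp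
    ring
  have hcoef : 0 ≤ q ^ 2 * (1 - l ^ 2) * (-l) / (2 * (1 + η * l) ^ 2) := by
    have : 0 ≤ 1 - l ^ 2 := by nlinarith
    have : 0 ≤ -l := by linarith
    positivity
  have hle : η₁ t ≤ η₂ t := by
    rw [h₁, h₂]
    exact div_le_div_of_nonpos_of_le hl0.le (by linarith)
  rw [hfactor]
  refine ⟨fun h => ?_, fun h => ?_, fun h => ?_⟩
  · exact mul_nonpos_of_nonneg_of_nonpos hcoef
      (mul_nonpos_of_nonneg_of_nonpos (by linarith [h.1]) (by linarith [h.2]))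
  · rcases h with h | h <;> simp [← h]
  · refine mul_nonneg hcoef ?_
    rcases h with h | h
    · exact mul_nonneg_of_nonpos_of_nonpos (by linarith [h.2]) (by linarith [h.2])
    · exact mul_nonneg (by linarith) (by linarith)
end
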